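/- arXiv:2409.08612 — 3 statements merged into one kernel-verified Lean document; each statement's English description precedes it below -/
import Mathlib

section
/- Let Ω ⊆ ℝ^d be a bounded convex set, μ a measure supported on Y ⊆ cl(Ω) with 1/2 ≤ μ(Ω)/|Ω| ≤ 2, and λ := (μ(Ω)/|Ω|) χ_Ω. Then for every v ∈ S(b_Ω², Y) optimizer of the dual formulation of Wb²_Ω(μ,λ) and every ṽ ∈ S(b_Ω², Y), setting u := Q_{b_Ω²}(v), ũ := Q_{b_Ω²}(ṽ) and ℓ := ( max{osc_Y(v), osc_Y(ṽ)} + d(cl(Ω),Y)² )^{1/2}, it holds Var_{Ω^{(3ℓ)}}(u − ũ) ≤ C diam(Ω)² [ Wb²_Ω(μ,λ) − ( ∫_Ω ũ dλ − ∫_Y ṽ dμ ) ], where C depends only on d. -/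
open MeasureTheory Metric Set Filter
open scoped ENNReal NNReal Topology

noncomputable section

/-- The set of couplings between two measures: Borel measures on the product whose
first marginal is `lam` and second marginal is `μ`. -/
def couplings {X : Type*} [MeasurableSpace X] (μ lam : Measure X) : Set (Measure (X × X)) :=
  {π | π.map Prod.fst = lam ∧ π.map Prod.snd = μ}

/-- Optimal transport cost for a cost function `c` (extended-real valued). -/
def transportCostE {X : Type*} [MeasurableSpace X] (c : X → X → ℝ) (μ lam : Measure X) : ℝ≥0∞ :=
  ⨅ π ∈ couplings μ lam, ∫⁻ z, ENNReal.ofReal (c z.1 z.2) ∂π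

/-- Optimal transport cost for a cost function `c` (real valued). -/
def transportCost {X : Type*} [MeasurableSpace X] (c : X → X → ℝ) (μ lam : Measure X) : ℝ :=
  (transportCostE c μ lam).toReal

/-- The boundary pseudo-distance `b_Ω(x,y) = min{d(x,y), (d(x,Ω^c)² + d(y,Ω^c)²)^{1/2}}`
(here for general exponent `p`). -/
def bdist {X : Type*} [PseudoMetricSpace X] (p : ℝ) (Ω : Set X) (x y : X) : ℝ :=
  min (dist x y) ((infDist x Ωᶜ ^ p + infDist y Ωᶜ ^ p) ^ (1 / p))

/-- Boundary transport cost `Wb^p_Ω(μ, λ)` (between the restrictions to `Ω`). -/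
def Wb {X : Type*} [MeasurableSpace X] [PseudoMetricSpace X] (p : ℝ) (Ω : Set X)
    (μ lam : Measure X) : ℝ :=
  transportCost (fun x y => bdist p Ω x y ^ p) (μ.restrict Ω) (lam.restrict Ω)

/-- The cost transform `Q_{b_Ω^p}(v)(x) = inf_{y ∈ Y} (v(y) + b_Ω(x,y)^p)`. -/
def Qb {X : Type*} [PseudoMetricSpace X] (p : ℝ) (Ω Y : Set X) (v : X → ℝ) (x : X) : ℝ :=
  ⨅ y : Y, (v ↑y + bdist p Ω x ↑y ^ p)

/-- The dual transform `Q̂_{b_Ω^p}(u)(y) = sup_{x ∈ K} (u(x) − b_Ω(x,y)^p)` (ambient set `K`). -/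
def Qbhat {X : Type*} [PseudoMetricSpace X] (p : ℝ) (Ω K : Set X) (u : X → ℝ) (y : X) : ℝ :=
  ⨆ x : K, (u ↑x - bdist p Ω ↑x y ^ p)

/-- `S(b_Ω^p, Y)`: functions on `Y` which are dual transforms of some `u`. -/
def memS {X : Type*} [PseudoMetricSpace X] (p : ℝ) (Ω K Y : Set X) (v : X → ℝ) : Prop :=
  ∃ u : X → ℝ, ∀ y ∈ Y, v y = Qbhat p Ω K u y

/-- oscillation of `v` on `Y`. -/
def oscOn {X : Type*} (Y : Set X) (v : X → ℝ) : ℝ := sSup (v '' Y) - sInf (v '' Y)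

/-- `d(A,B) = sup_{x ∈ A} inf_{y ∈ B} d(x,y)`. -/
def supInfDist {X : Type*} [PseudoMetricSpace X] (A B : Set X) : ℝ :=
  sSup ((fun x => infDist x B) '' A)

/-- `Ω^{(r)} = {x ∈ Ω : d(x, Ω^c) > r}`. -/
def innerPart {X : Type*} [PseudoMetricSpace X] (Ω : Set X) (r : ℝ) : Set X :=
  {x ∈ Ω | r < infDist x Ωᶜ}

/-- `v` is an optimizer of the dual formulation of `Wb^p_Ω(μ, λ)`. -/
def IsDualOpt {X : Type*} [MeasurableSpace X] [PseudoMetricSpace X] (p : ℝ) (Ω K Y : Set X)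
    (v : X → ℝ) (μ lam : Measure X) : Prop :=
  memS p Ω K Y v ∧
    (∫ x, Qb p Ω Y v x ∂lam) - (∫ y in Y, v y ∂μ) = Wb p Ω μ lam

/-- Variance of `f` over `E` with respect to the Lebesgue measure: `inf_a ∫_E |f-a|²`. -/
def VarOn {d : ℕ} (E : Set (EuclideanSpace ℝ (Fin d))) (f : EuclideanSpace ℝ (Fin d) → ℝ) : ℝ :=
  ⨅ a : ℝ, ∫ x in E, (f x - a) ^ 2

/-- One-dimensional Brunn–Minkowski inequality for nonempty compact sets. -/
theorem volume_add_volume_le_of_isCompact {A B C : Set ℝ} (hA : IsCompact A) (hB : IsCompact B)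
    (hA0 : A.Nonempty) (hB0 : B.Nonempty) (h : ∀ x ∈ A, ∀ y ∈ B, x + y ∈ C) :
    volume A + volume B ≤ volume C := by
  set p := sSup A
  set q := sInf B
  have hp : p ∈ A := hA.sSup_mem hA0
  have hq : q ∈ B := hB.sInf_mem hB0
  have h1 : volume ((fun x => q + x) '' A) = volume A := by simp
  have h2 : volume ((fun x => p + x) '' B) = volume B := by simp
  have hm : MeasurableSet ((fun x => p + x) '' B) :=
    (hB.image (by fun_prop)).measurableSet
  have hd : AEDisjoint volume ((fun x => q + x) '' A) ((fun x => p + x) '' B) := by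
    refine measure_mono_null (t := {p + q}) ?_ (by simp)
    rintro z ⟨⟨x, hx, rfl⟩, ⟨y, hy, hxy⟩⟩
    have := le_csSup hA.bddAbove hx
    have := csInf_le hB.bddBelow hy
    simp only [mem_singleton_iff] at *
    linarith
  rw [← h1, ← h2, ← measure_union₀ hm.nullMeasurableSet hd]
  refine measure_mono ?_
  rintro z (⟨x, hx, rfl⟩ | ⟨y, hy, rfl⟩)
  · simpa [add_comm] using h x hx q hq
  · exact h p hp y hy

/-- One-dimensional Brunn–Minkowski inequality. -/
theorem volume_add_volume_le {A B C : Set ℝ} (hA : MeasurableSet A) (hB : MeasurableSet B)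
    (hA0 : A.Nonempty) (hB0 : B.Nonempty) (h : ∀ x ∈ A, ∀ y ∈ B, x + y ∈ C) :
    volume A + volume B ≤ volume C := by
  obtain ⟨a₀, ha₀⟩ := hA0
  obtain ⟨b₀, hb₀⟩ := hB0
  refine le_of_forall_lt fun r hr => ?_
  obtain ⟨K, hK, hKc, L, hL, hLc, hr⟩ : ∃ K ⊆ A, IsCompact K ∧ ∃ L ⊆ B, IsCompact L ∧
      r < volume K + volume L := by
    by_contra! hcon
    refine hr.not_ge ?_
    simp only [hA.measure_eq_iSup_isCompact, hB.measure_eq_iSup_isCompact, iSup_and']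
    exact ENNReal.biSup_add_biSup_le' ⟨∅, by simp⟩ ⟨∅, by simp⟩
      fun K hK L hL => hcon K hK.1 hK.2 L hL.1 hL.2
  refine hr.trans_le ((add_le_add (measure_mono (subset_insert a₀ K))
    (measure_mono (subset_insert b₀ L))).trans ?_)
  refine volume_add_volume_le_of_isCompact (hKc.insert _) (hLc.insert _) (insert_nonempty _ _)
    (insert_nonempty _ _) fun x hx y hy => h x ?_ y ?_
  · exact insert_subset ha₀ hK hx
  · exact insert_subset hb₀ hL hy

open scoped Pointwise in
/-- One-dimensional Brunn–Minkowski inequality for convex combinations. -/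
theorem weighted_volume_add_volume_le {a b : ℝ} (ha : 0 < a) (hb : 0 < b) {A B C : Set ℝ}
    (hA : MeasurableSet A) (hB : MeasurableSet B) (hA0 : A.Nonempty) (hB0 : B.Nonempty)
    (h : ∀ x ∈ A, ∀ y ∈ B, a * x + b * y ∈ C) :
    ENNReal.ofReal a * volume A + ENNReal.ofReal b * volume B ≤ volume C := by
  have h1 : volume (a • A) = ENNReal.ofReal a * volume A := by
    simp [Measure.addHaar_smul, abs_of_pos ha]
  have h2 : volume (b • B) = ENNReal.ofReal b * volume B := by
    simp [Measure.addHaar_smul, abs_of_pos hb]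
  rw [← h1, ← h2]
  refine volume_add_volume_le (hA.const_smul₀ a) (hB.const_smul₀ b) hA0.smul_set hB0.smul_set ?_
  rintro _ ⟨x, hx, rfl⟩ _ ⟨y, hy, rfl⟩
  exact h x hx y hy

theorem lintegral_eq_lintegral_meas_lt_of_le_one {f : ℝ → ℝ≥0∞} (hf : Measurable f)
    (h1 : ∀ x, f x ≤ 1) :
    ∫⁻ x, f x = ∫⁻ s in Ioi (0 : ℝ), volume {x | ENNReal.ofReal s < f x} := by
  have hfin : ∀ x, f x ≠ ∞ := fun x => ((h1 x).trans_lt ENNReal.one_lt_top).ne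
  have := lintegral_eq_lintegral_meas_lt (f := fun x => (f x).toReal) volume
    (Eventually.of_forall fun x => ENNReal.toReal_nonneg) hf.ennreal_toReal.aemeasurable
  simp only [ENNReal.ofReal_toReal (hfin _)] at this
  rw [this]
  refine setLIntegral_congr_fun measurableSet_Ioi fun s hs => ?_
  simp only [ENNReal.ofReal_lt_iff_lt_toReal (le_of_lt hs) (hfin _)]

theorem ENNReal.geom_mean_le_arith_mean2 {a b : ℝ} (ha : 0 < a) (hb : 0 < b) (hab : a + b = 1)
    (p q : ℝ≥0∞) : p ^ a * q ^ b ≤ ENNReal.ofReal a * p + ENNReal.ofReal b * q := by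
  rcases eq_or_ne p ∞ with rfl | hp
  · simp [ENNReal.mul_top, ha]
  rcases eq_or_ne q ∞ with rfl | hq
  · simp [ENNReal.mul_top, hb]
  lift p to ℝ≥0 using hp
  lift q to ℝ≥0 using hq
  lift a to ℝ≥0 using ha.le
  lift b to ℝ≥0 using hb.le
  rw [← ENNReal.coe_rpow_of_nonneg _ ha.le, ← ENNReal.coe_rpow_of_nonneg _ hb.le,
    ENNReal.ofReal_coe_nnreal, ENNReal.ofReal_coe_nnreal]
  exact_mod_cast NNReal.geom_mean_le_arith_mean2_weighted a b p q (by exact_mod_cast hab)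

/-- One-dimensional Prékopa–Leindler inequality, in additive form, for normalized functions. -/
theorem arith_lintegral_le_of_iSup_eq_one {a b : ℝ} (ha : 0 < a) (hb : 0 < b) (hab : a + b = 1)
    {f g h : ℝ → ℝ≥0∞} (hf : Measurable f) (hg : Measurable g) (hh : Measurable h)
    (hf1 : ⨆ x, f x = 1) (hg1 : ⨆ x, g x = 1)
    (hfgh : ∀ x y, f x ^ a * g y ^ b ≤ h (a * x + b * y)) :
    ENNReal.ofReal a * (∫⁻ x, f x) + ENNReal.ofReal b * (∫⁻ x, g x) ≤ ∫⁻ x, h x := by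
  have hf1' : ∀ x, f x ≤ 1 := fun x => hf1 ▸ le_iSup f x
  have hg1' : ∀ x, g x ≤ 1 := fun x => hg1 ▸ le_iSup g x
  have hmono : ∀ F : ℝ → ℝ≥0∞, Measurable fun s : ℝ => volume {x | ENNReal.ofReal s < F x} :=
    fun F => Antitone.measurable fun s s' hs => measure_mono fun x hx =>
      (ENNReal.ofReal_le_ofReal hs).trans_lt hx
  calc ENNReal.ofReal a * (∫⁻ x, f x) + ENNReal.ofReal b * (∫⁻ x, g x)
      = ∫⁻ s in Ioi (0 : ℝ), (ENNReal.ofReal a * volume {x | ENNReal.ofReal s < f x}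
          + ENNReal.ofReal b * volume {x | ENNReal.ofReal s < g x}) := by
        rw [lintegral_eq_lintegral_meas_lt_of_le_one hf hf1',
          lintegral_eq_lintegral_meas_lt_of_le_one hg hg1', lintegral_add_left,
          lintegral_const_mul _ (hmono f), lintegral_const_mul _ (hmono g)]
        exact (hmono f).const_mul _
    _ ≤ ∫⁻ s in Ioi (0 : ℝ), volume {x | ENNReal.ofReal s < min (h x) 1} := by
        refine setLIntegral_mono (hmono _) fun s hs => ?_
        rcases lt_or_ge s 1 with hs1 | hs1
        · have hs1' : ENNReal.ofReal s < 1 := by simpa using hs1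
          refine weighted_volume_add_volume_le ha hb (measurableSet_lt measurable_const hf)
            (measurableSet_lt measurable_const hg) (lt_iSup_iff.1 (hs1'.trans_eq hf1.symm))
            (lt_iSup_iff.1 (hs1'.trans_eq hg1.symm)) fun x hx y hy => ?_
          refine lt_min (lt_of_lt_of_le ?_ (hfgh x y)) hs1'
          have : ENNReal.ofReal s = ENNReal.ofReal s ^ a * ENNReal.ofReal s ^ b := by
            rw [← ENNReal.rpow_add_of_nonneg _ _ ha.le hb.le, hab, ENNReal.rpow_one]
          rw [this]
          exact ENNReal.mul_lt_mul (ENNReal.rpow_lt_rpow hx ha) (ENNReal.rpow_lt_rpow hy hb)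
        · have : (1 : ℝ≥0∞) ≤ ENNReal.ofReal s := by simpa using hs1
          have e1 : {x | ENNReal.ofReal s < f x} = ∅ :=
            eq_empty_of_forall_notMem fun x hx => (((hf1' x).trans this).trans_lt hx).false
          have e2 : {x | ENNReal.ofReal s < g x} = ∅ :=
            eq_empty_of_forall_notMem fun x hx => (((hg1' x).trans this).trans_lt hx).false
          simp [e1, e2]
    _ = ∫⁻ x, min (h x) 1 := (lintegral_eq_lintegral_meas_lt_of_le_one (hh.min measurable_const)
        fun x => min_le_right _ _).symm
    _ ≤ ∫⁻ x, h x := lintegral_mono fun x => min_le_left _ _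

/-- Prékopa–Leindler inequality on the line, for bounded functions. -/
theorem prekopaLeindler_real_of_iSup_ne_top {a b : ℝ} (ha : 0 < a) (hb : 0 < b) (hab : a + b = 1)
    {f g h : ℝ → ℝ≥0∞} (hf : Measurable f) (hg : Measurable g) (hh : Measurable h)
    (hf1 : ⨆ x, f x ≠ ∞) (hg1 : ⨆ x, g x ≠ ∞)
    (hfgh : ∀ x y, f x ^ a * g y ^ b ≤ h (a * x + b * y)) :
    (∫⁻ x, f x) ^ a * (∫⁻ x, g x) ^ b ≤ ∫⁻ x, h x := by
  set p := ⨆ x, f x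
  set q := ⨆ x, g x
  rcases eq_or_ne p 0 with hp | hp
  · have : ∀ x, f x = 0 := fun x => le_antisymm (hp ▸ le_iSup f x) zero_le
    simp [this, ha]
  rcases eq_or_ne q 0 with hq | hq
  · have : ∀ x, g x = 0 := fun x => le_antisymm (hq ▸ le_iSup g x) zero_le
    simp [this, hb]
  set c := p ^ a * q ^ b
  have hpa : p ^ a ≠ 0 := by simp [hp, hf1]
  have hqb : q ^ b ≠ 0 := by simp [hq, hg1]
  have hpa' : p ^ a ≠ ∞ := ENNReal.rpow_ne_top_of_nonneg ha.le hf1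
  have hqb' : q ^ b ≠ ∞ := ENNReal.rpow_ne_top_of_nonneg hb.le hg1
  have hc0 : c ≠ 0 := mul_ne_zero hpa hqb
  have hct : c ≠ ∞ := ENNReal.mul_ne_top hpa' hqb'
  have hcinv : c⁻¹ = p⁻¹ ^ a * q⁻¹ ^ b := by
    rw [ENNReal.mul_inv (Or.inl hpa) (Or.inl hpa'), ENNReal.inv_rpow, ENNReal.inv_rpow]
  have key := arith_lintegral_le_of_iSup_eq_one ha hb hab (f := fun x => p⁻¹ * f x)
    (g := fun x => q⁻¹ * g x) (h := fun x => c⁻¹ * h x) (hf.const_mul _) (hg.const_mul _)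
    (hh.const_mul _) (by rw [← ENNReal.mul_iSup, ENNReal.inv_mul_cancel hp hf1])
    (by rw [← ENNReal.mul_iSup, ENNReal.inv_mul_cancel hq hg1]) fun x y => by
      rw [ENNReal.mul_rpow_of_nonneg _ _ ha.le, ENNReal.mul_rpow_of_nonneg _ _ hb.le,
        mul_mul_mul_comm, ← hcinv]
      gcongr
      exact hfgh x y
  replace key := (ENNReal.geom_mean_le_arith_mean2 ha hb hab _ _).trans key
  rw [lintegral_const_mul _ hf, lintegral_const_mul _ hg, lintegral_const_mul _ hh,
    ENNReal.mul_rpow_of_nonneg _ _ ha.le, ENNReal.mul_rpow_of_nonneg _ _ hb.le,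
    mul_mul_mul_comm, ← hcinv] at key
  rwa [ENNReal.mul_le_mul_iff_right (ENNReal.inv_ne_zero.2 hct) (ENNReal.inv_ne_top.2 hc0)] at key

/-- Prékopa–Leindler inequality on the line. -/
theorem prekopaLeindler_real {a b : ℝ} (ha : 0 < a) (hb : 0 < b) (hab : a + b = 1)
    {f g h : ℝ → ℝ≥0∞} (hf : Measurable f) (hg : Measurable g) (hh : Measurable h)
    (hfgh : ∀ x y, f x ^ a * g y ^ b ≤ h (a * x + b * y)) :
    (∫⁻ x, f x) ^ a * (∫⁻ x, g x) ^ b ≤ ∫⁻ x, h x := by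
  have trunc : ∀ {F : ℝ → ℝ≥0∞}, Measurable F →
      Tendsto (fun n : ℕ => ∫⁻ x, min (F x) n) atTop (𝓝 (∫⁻ x, F x)) := fun {F} hF =>
    lintegral_tendsto_of_tendsto_of_monotone (fun n => (hF.min measurable_const).aemeasurable)
      (Eventually.of_forall fun x n m hnm => min_le_min le_rfl (by exact_mod_cast hnm))
      (Eventually.of_forall fun x => by
        simpa using tendsto_const_nhds.min ENNReal.tendsto_nat_nhds_top)
  have key : ∀ n : ℕ, (∫⁻ x, min (f x) n) ^ a * (∫⁻ x, min (g x) n) ^ b ≤ ∫⁻ x, h x := fun n =>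
    prekopaLeindler_real_of_iSup_ne_top ha hb hab (hf.min measurable_const)
      (hg.min measurable_const) hh
      (ne_top_of_le_ne_top (ENNReal.natCast_ne_top n) (iSup_le fun x => min_le_right _ _))
      (ne_top_of_le_ne_top (ENNReal.natCast_ne_top n) (iSup_le fun x => min_le_right _ _))
      fun x y => (mul_le_mul' (ENNReal.rpow_le_rpow (min_le_left _ _) ha.le)
        (ENNReal.rpow_le_rpow (min_le_left _ _) hb.le)).trans (hfgh x y)
  rcases eq_or_ne (∫⁻ x, f x) 0 with hf0 | hf0
  · simp [hf0, ha]
  rcases eq_or_ne (∫⁻ x, g x) 0 with hg0 | hg0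
  · simp [hg0, hb]
  refine le_of_tendsto' (ENNReal.Tendsto.mul ((trunc hf).ennrpow_const a) (Or.inl ?_)
    ((trunc hg).ennrpow_const b) (Or.inl ?_)) key
  · simp [hf0, ha.le]
  · simp [hg0, hb.le]

/-- The Prékopa–Leindler inequality, as a property of a measure on a real vector space. -/
def IsPrekopaLeindler {E : Type*} [AddCommGroup E] [Module ℝ E] [MeasurableSpace E]
    (ν : Measure E) : Prop :=
  ∀ ⦃a b : ℝ⦄, 0 < a → 0 < b → a + b = 1 → ∀ ⦃f g h : E → ℝ≥0∞⦄, Measurable f → Measurable g →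
    Measurable h → (∀ x y, f x ^ a * g y ^ b ≤ h (a • x + b • y)) →
      (∫⁻ x, f x ∂ν) ^ a * (∫⁻ x, g x ∂ν) ^ b ≤ ∫⁻ x, h x ∂ν

theorem isPrekopaLeindler_volume_real : IsPrekopaLeindler (volume : Measure ℝ) :=
  fun _ _ ha hb hab _ _ _ hf hg hh hfgh => prekopaLeindler_real ha hb hab hf hg hh hfgh

theorem isPrekopaLeindler_dirac {E : Type*} [AddCommGroup E] [Module ℝ E] [MeasurableSpace E] :
    IsPrekopaLeindler (Measure.dirac (0 : E)) := by
  intro a b ha hb hab f g h hf hg hh hfgh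
  simpa [lintegral_dirac' _ hf, lintegral_dirac' _ hg, lintegral_dirac' _ hh] using hfgh 0 0

theorem IsPrekopaLeindler.prod {E F : Type*} [AddCommGroup E] [Module ℝ E] [MeasurableSpace E]
    [AddCommGroup F] [Module ℝ F] [MeasurableSpace F] {ν : Measure E} {ν' : Measure F}
    [SFinite ν'] (h1 : IsPrekopaLeindler ν) (h2 : IsPrekopaLeindler ν') :
    IsPrekopaLeindler (ν.prod ν') := by
  intro a b ha hb hab f g h hf hg hh hfgh
  rw [lintegral_prod _ hf.aemeasurable, lintegral_prod _ hg.aemeasurable,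
    lintegral_prod _ hh.aemeasurable]
  exact h1 ha hb hab hf.lintegral_prod_right' hg.lintegral_prod_right' hh.lintegral_prod_right'
    fun x y => h2 ha hb hab (hf.comp measurable_prodMk_left) (hg.comp measurable_prodMk_left)
      (hh.comp measurable_prodMk_left) fun z w => hfgh (x, z) (y, w)

theorem IsPrekopaLeindler.of_measurePreserving {E F : Type*} [AddCommGroup E] [Module ℝ E]
    [MeasurableSpace E] [AddCommGroup F] [Module ℝ F] [MeasurableSpace F] {ν : Measure E}
    {ν' : Measure F} (h1 : IsPrekopaLeindler ν) {T : E → F} (hT : MeasurePreserving T ν ν')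
    (hlin : ∀ (a b : ℝ) (x y : E), T (a • x + b • y) = a • T x + b • T y) :
    IsPrekopaLeindler ν' := by
  intro a b ha hb hab f g h hf hg hh hfgh
  rw [← hT.lintegral_comp hf, ← hT.lintegral_comp hg, ← hT.lintegral_comp hh]
  exact h1 ha hb hab (hf.comp hT.measurable) (hg.comp hT.measurable) (hh.comp hT.measurable)
    fun x y => by rw [hlin]; exact hfgh _ _

theorem isPrekopaLeindler_volume_pi (n : ℕ) :
    IsPrekopaLeindler (volume : Measure (Fin n → ℝ)) := by
  induction n with
  | zero =>
    rw [Measure.volume_pi_eq_dirac 0]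
    exact isPrekopaLeindler_dirac
  | succ n ih =>
    refine (isPrekopaLeindler_volume_real.prod ih).of_measurePreserving
      (volume_preserving_piFinSuccAbove (fun _ : Fin (n + 1) => ℝ) 0).symm fun a b x y => ?_
    ext i
    refine Fin.cases ?_ (fun j => ?_) i <;> simp [MeasurableEquiv.piFinSuccAbove]

theorem isPrekopaLeindler_volume_euclideanSpace (n : ℕ) :
    IsPrekopaLeindler (volume : Measure (EuclideanSpace ℝ (Fin n))) :=
  (isPrekopaLeindler_volume_pi n).of_measurePreserving (PiLp.volume_preserving_toLp (Fin n))
    fun _ _ _ _ => rfl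

theorem IsPrekopaLeindler.setIntegral_exp {E : Type*} [AddCommGroup E] [Module ℝ E]
    [MeasurableSpace E] {ν : Measure E} (hν : IsPrekopaLeindler ν) {S : Set E}
    (hS : MeasurableSet S) (hSc : Convex ℝ S) {a b : ℝ} (ha : 0 < a) (hb : 0 < b) (hab : a + b = 1)
    {φ₀ φ₁ φ : E → ℝ} (h₀ : Measurable φ₀) (h₁ : Measurable φ₁) (h : Measurable φ)
    (hi₀ : IntegrableOn (fun x => Real.exp (-φ₀ x)) S ν)
    (hi₁ : IntegrableOn (fun x => Real.exp (-φ₁ x)) S ν)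
    (hi : IntegrableOn (fun x => Real.exp (-φ x)) S ν)
    (hφ : ∀ x ∈ S, ∀ y ∈ S, φ (a • x + b • y) ≤ a * φ₀ x + b * φ₁ y) :
    (∫ x in S, Real.exp (-φ₀ x) ∂ν) ^ a * (∫ x in S, Real.exp (-φ₁ x) ∂ν) ^ b ≤
      ∫ x in S, Real.exp (-φ x) ∂ν := by
  have hpos : ∀ ψ : E → ℝ, 0 ≤ ∫ x in S, Real.exp (-ψ x) ∂ν := fun ψ =>
    integral_nonneg fun x => (Real.exp_pos _).le
  have conv : ∀ {ψ : E → ℝ}, IntegrableOn (fun x => Real.exp (-ψ x)) S ν →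
      ∫⁻ x, S.indicator (fun x => ENNReal.ofReal (Real.exp (-ψ x))) x ∂ν =
        ENNReal.ofReal (∫ x in S, Real.exp (-ψ x) ∂ν) := fun {ψ} hψ => by
    rw [lintegral_indicator hS, ofReal_integral_eq_lintegral_ofReal hψ
      (Eventually.of_forall fun x => (Real.exp_pos _).le)]
  have hmeas : ∀ {ψ : E → ℝ}, Measurable ψ →
      Measurable (S.indicator fun x => ENNReal.ofReal (Real.exp (-ψ x))) := fun hψ =>
    Measurable.indicator (by fun_prop) hS
  have key := hν ha hb hab (hmeas h₀) (hmeas h₁) (hmeas h) fun x y => by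
    by_cases hx : x ∈ S
    · by_cases hy : y ∈ S
      · rw [indicator_of_mem hx, indicator_of_mem hy,
          indicator_of_mem (hSc hx hy ha.le hb.le hab),
          ENNReal.ofReal_rpow_of_pos (Real.exp_pos _), ENNReal.ofReal_rpow_of_pos (Real.exp_pos _),
          ← ENNReal.ofReal_mul (by positivity), ← Real.exp_mul, ← Real.exp_mul, ← Real.exp_add]
        refine ENNReal.ofReal_le_ofReal (Real.exp_le_exp.2 ?_)
        linarith [hφ x hx y hy]
      · simp [hy, hb]
    · simp [hx, ha]
  rw [conv hi₀, conv hi₁, conv hi, ENNReal.ofReal_rpow_of_nonneg (hpos _) ha.le,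
    ENNReal.ofReal_rpow_of_nonneg (hpos _) hb.le,
    ← ENNReal.ofReal_mul (by have := hpos φ₀; positivity)] at key
  exact (ENNReal.ofReal_le_ofReal_iff (hpos _)).1 key

theorem one_add_add_sq_div_four_le_exp {x : ℝ} (hx : -2 ≤ x) : 1 + x + x ^ 2 / 4 ≤ Real.exp x := by
  have h1 := Real.add_one_le_exp (x / 2)
  have h2 : Real.exp x = Real.exp (x / 2) * Real.exp (x / 2) := by
    rw [← Real.exp_add]; ring_nf
  nlinarith

/-- A variance inequality obtained by linearizing the Prékopa–Leindler inequality. -/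
theorem IsPrekopaLeindler.exists_variance_le {E : Type*} [AddCommGroup E] [Module ℝ E]
    [MeasurableSpace E] {ν : Measure E} (hν : IsPrekopaLeindler ν) {S : Set E}
    (hS : MeasurableSet S) (hSc : Convex ℝ S) (hS0 : ν S ≠ 0) (hSt : ν S ≠ ∞)
    {φ₀ φ₁ : E → ℝ} {φ : ℝ → E → ℝ} (h₀ : Measurable φ₀) (h₁ : Measurable φ₁)
    (h : ∀ t, Measurable (φ t)) {M : ℝ} (hM : 0 ≤ M)
    (hb₀ : ∀ x ∈ S, φ₀ x ∈ Icc 0 2) (hw : ∀ x ∈ S, |φ₁ x - φ₀ x| ≤ 1)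
    (hδ : ∀ t ∈ Ioo (0 : ℝ) 1, ∀ x ∈ S, |φ t x - φ₀ x| ≤ M * t)
    (hφ : ∀ t ∈ Ioo (0 : ℝ) 1, ∀ x ∈ S, ∀ y ∈ S,
      φ t ((1 - t) • x + t • y) ≤ (1 - t) * φ₀ x + t * φ₁ y) :
    ∃ k K : ℝ, ∀ᶠ t in 𝓝[>] (0 : ℝ), Real.exp (-2) / 4 * ∫ x in S, (φ₁ x - φ₀ x + k) ^ 2 ∂ν ≤
      (∫ x in S, (φ₁ x - φ₀ x - (φ t x - φ₀ x) / t) ∂ν) + K * t := by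
  have hfin : IsFiniteMeasure (ν.restrict S) := ⟨by simpa using hSt.lt_top⟩
  have hint : ∀ {f : E → ℝ}, Measurable f → (∃ B, ∀ x ∈ S, |f x| ≤ B) → IntegrableOn f S ν := by
    rintro f hf ⟨B, hB⟩
    exact Integrable.of_bound hf.aestronglyMeasurable B
      ((ae_restrict_iff' hS).2 (Eventually.of_forall fun x hx => by simpa using hB x hx))
  have hpos : ∀ {f : E → ℝ}, IntegrableOn f S ν → (∀ x, 0 < f x) → 0 < ∫ x in S, f x ∂ν := by
    intro f hf hf0
    rw [integral_pos_iff_support_of_nonneg (fun x => (hf0 x).le) hf]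
    have : Function.support f = univ := eq_univ_of_forall fun x => (hf0 x).ne'
    rw [this]
    simpa [pos_iff_ne_zero] using hS0
  have hiexp : ∀ {ψ : E → ℝ}, Measurable ψ → (∃ B, ∀ x ∈ S, |ψ x| ≤ B) →
      IntegrableOn (fun x => Real.exp (-ψ x)) S ν := by
    rintro ψ hψ ⟨B, hB⟩
    refine hint (by fun_prop) ⟨Real.exp B, fun x hx => ?_⟩
    rw [abs_of_pos (Real.exp_pos _)]
    exact Real.exp_le_exp.2 ((neg_le_abs _).trans (hB x hx))
  have hi₀ : IntegrableOn (fun x => Real.exp (-φ₀ x)) S ν :=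
    hiexp h₀ ⟨2, fun x hx => abs_le.2 ⟨by linarith [(hb₀ x hx).1], (hb₀ x hx).2⟩⟩
  have hi₁ : IntegrableOn (fun x => Real.exp (-φ₁ x)) S ν :=
    hiexp h₁ ⟨3, fun x hx => abs_le.2 ⟨by linarith [(hb₀ x hx).1, (abs_le.1 (hw x hx)).1],
      by linarith [(hb₀ x hx).2, (abs_le.1 (hw x hx)).2]⟩⟩
  set Z₀ := ∫ x in S, Real.exp (-φ₀ x) ∂ν
  set Z₁ := ∫ x in S, Real.exp (-φ₁ x) ∂ν
  have hZ₀ : 0 < Z₀ := hpos hi₀ fun x => Real.exp_pos _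
  have hZ₁ : 0 < Z₁ := hpos hi₁ fun x => Real.exp_pos _
  set k := Real.log (Z₁ / Z₀) with hk
  have hek : Real.exp k = Z₁ / Z₀ := Real.exp_log (by positivity)
  have hk1 : |k| ≤ 1 := by
    have hmono : ∀ c : ℝ, Real.exp c * Z₀ = ∫ x in S, Real.exp (-φ₀ x + c) ∂ν := fun c => by
      rw [← integral_const_mul]
      exact integral_congr_ae (Eventually.of_forall fun x => by
        simp only [Real.exp_add]; ring)
    have hic : ∀ c : ℝ, IntegrableOn (fun x => Real.exp (-φ₀ x + c)) S ν := fun c => by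
      simp only [Real.exp_add]
      exact hi₀.mul_const _
    rw [abs_le]
    constructor
    · rw [← Real.exp_le_exp, hek, le_div_iff₀ hZ₀, hmono]
      refine setIntegral_mono_on (hic _) hi₁ hS fun x hx => Real.exp_le_exp.2 ?_
      linarith [(abs_le.1 (hw x hx)).2]
    · rw [← Real.exp_le_exp, hek, div_le_iff₀ hZ₀, hmono]
      refine setIntegral_mono_on hi₁ (hic _) hS fun x hx => Real.exp_le_exp.2 ?_
      linarith [(abs_le.1 (hw x hx)).1]
  refine ⟨k, (M + 1) ^ 2 * Z₀, ?_⟩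
  have ht0 : (0 : ℝ) < min (1 / (M + 1)) 1 := by positivity
  filter_upwards [Ioo_mem_nhdsGT ht0] with t ht
  obtain ⟨ht0, ht1⟩ := ht
  have htM : (M + 1) * t ≤ 1 := by
    have := (lt_min_iff.1 ht1).1
    rw [lt_div_iff₀ (by positivity)] at this
    linarith
  replace ht1 := (lt_min_iff.1 ht1).2
  have hmem : t ∈ Ioo (0 : ℝ) 1 := ⟨ht0, ht1⟩
  have hit : IntegrableOn (fun x => Real.exp (-φ t x)) S ν :=
    hiexp (h t) ⟨M + 2, fun x hx => by
      have h1 := abs_le.1 (hδ t hmem x hx)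
      have h2 := hb₀ x hx
      have h3 : M * t ≤ M := by nlinarith
      exact abs_le.2 ⟨by linarith [h2.1], by linarith [h2.2]⟩⟩
  have hPL := hν.setIntegral_exp hS hSc (by linarith : 0 < 1 - t) ht0 (by ring) h₀ h₁ (h t)
    hi₀ hi₁ hit (hφ t hmem)
  set w := fun x => φ₁ x - φ₀ x + k with hwdef
  set δ := fun x => φ t x - φ₀ x + t * k with hδdef
  have hwm : Measurable w := by fun_prop
  have hδm : Measurable δ := ((h t).sub h₀).add_const _
  have hwb : ∀ x ∈ S, |w x| ≤ 2 := fun x hx =>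
    (abs_add_le _ _).trans (by linarith [hw x hx])
  have hδb : ∀ x ∈ S, |δ x| ≤ (M + 1) * t := fun x hx => by
    refine (abs_add_le _ _).trans ?_
    rw [abs_mul, abs_of_pos ht0]
    nlinarith [hδ t hmem x hx]
  have hE : Measurable fun x => Real.exp (-φ₀ x) := by fun_prop
  have hEb : ∀ x ∈ S, |Real.exp (-φ₀ x)| ≤ 1 := fun x hx => by
    rw [abs_of_pos (Real.exp_pos _)]
    exact Real.exp_le_one_iff.2 (by linarith [(hb₀ x hx).1])
  have hintE : ∀ {f : E → ℝ}, Measurable f → (∃ B, ∀ x ∈ S, |f x| ≤ B) →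
      IntegrableOn (fun x => Real.exp (-φ₀ x) * f x) S ν := by
    rintro f hf ⟨B, hB⟩
    refine hint (hE.mul hf) ⟨B, fun x hx => ?_⟩
    rw [abs_mul]
    exact (mul_le_of_le_one_left (abs_nonneg _) (hEb x hx)).trans (hB x hx)
  -- the linearization of the Prékopa–Leindler inequality
  have hδE : ∫ x in S, Real.exp (-φ₀ x) * δ x ∂ν ≤ ((M + 1) * t) ^ 2 * Z₀ := by
    have h1 : Z₀ * Real.exp (t * k) ≤ ∫ x in S, Real.exp (-φ t x) ∂ν := by
      refine le_of_eq_of_le ?_ hPL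
      have : Z₁ = Z₀ * Real.exp k := by rw [hek]; field_simp
      change _ = Z₀ ^ (1 - t) * Z₁ ^ t
      rw [this, Real.mul_rpow hZ₀.le (Real.exp_pos _).le, ← Real.exp_mul, ← mul_assoc,
        ← Real.rpow_add hZ₀, sub_add_cancel, Real.rpow_one, mul_comm k]
    have h2 : Z₀ ≤ ∫ x in S, Real.exp (-φ₀ x) * Real.exp (-δ x) ∂ν := by
      have : ∀ x, Real.exp (-φ₀ x) * Real.exp (-δ x) = Real.exp (-φ t x) * Real.exp (-(t * k)) :=
        fun x => by rw [← Real.exp_add, ← Real.exp_add]; simp only [hδdef]; ring_nf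
      simp only [this]
      rw [integral_mul_const, Real.exp_neg, ← div_eq_mul_inv, le_div_iff₀ (Real.exp_pos _)]
      exact h1
    have h3 : ∫ x in S, Real.exp (-φ₀ x) * Real.exp (-δ x) ∂ν ≤
        ∫ x in S, (Real.exp (-φ₀ x) * (1 + ((M + 1) * t) ^ 2) - Real.exp (-φ₀ x) * δ x) ∂ν := by
      refine setIntegral_mono_on ?_ ?_ hS fun x hx => ?_
      · refine hintE (by fun_prop) ⟨Real.exp 1, fun x hx => ?_⟩
        rw [abs_of_pos (Real.exp_pos _)]
        exact Real.exp_le_exp.2 ((neg_le_abs _).trans ((hδb x hx).trans htM))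
      · exact (hi₀.mul_const _).sub (hintE hδm ⟨_, hδb⟩)
      · rw [← mul_sub]
        refine mul_le_mul_of_nonneg_left ?_ (Real.exp_pos _).le
        have h4 := Real.abs_exp_sub_one_sub_id_le (x := -δ x)
          (by rw [abs_neg]; exact (hδb x hx).trans htM)
        have h5 : δ x ^ 2 ≤ ((M + 1) * t) ^ 2 := sq_le_sq' (abs_le.1 (hδb x hx)).1
          (abs_le.1 (hδb x hx)).2
        rw [neg_sq] at h4
        linarith [(abs_le.1 h4).2]
    rw [integral_sub (hi₀.mul_const _) (hintE hδm ⟨_, hδb⟩), integral_mul_const] at h3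
    linarith [h2.trans h3, show Z₀ * (1 + ((M + 1) * t) ^ 2) = Z₀ + ((M + 1) * t) ^ 2 * Z₀ by ring]
  have hw2m : Measurable fun x => w x ^ 2 := by fun_prop
  have hw2b : ∃ B, ∀ x ∈ S, |w x ^ 2| ≤ B := ⟨4, fun x hx => by
    have := hwb x hx
    rw [abs_pow]
    nlinarith [abs_nonneg (w x)]⟩
  have hwE : 1 / 4 * ∫ x in S, Real.exp (-φ₀ x) * w x ^ 2 ∂ν ≤
      ∫ x in S, Real.exp (-φ₀ x) * w x ∂ν := by
    have h2 : ∫ x in S, Real.exp (-φ₀ x) * Real.exp (-w x) ∂ν = Z₀ := by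
      have : ∀ x, Real.exp (-φ₀ x) * Real.exp (-w x) = Real.exp (-φ₁ x) * Real.exp (-k) :=
        fun x => by rw [← Real.exp_add, ← Real.exp_add]; simp only [hwdef]; ring_nf
      simp only [this]
      rw [integral_mul_const, Real.exp_neg, hek]
      change Z₁ * (Z₁ / Z₀)⁻¹ = Z₀
      field_simp
    have hi : IntegrableOn (fun x => Real.exp (-φ₀ x) - Real.exp (-φ₀ x) * w x) S ν :=
      hi₀.sub (hintE hwm ⟨_, hwb⟩)
    have h3 : ∫ x in S, (Real.exp (-φ₀ x) - Real.exp (-φ₀ x) * w x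
          + 1 / 4 * (Real.exp (-φ₀ x) * w x ^ 2)) ∂ν ≤
        ∫ x in S, Real.exp (-φ₀ x) * Real.exp (-w x) ∂ν := by
      refine setIntegral_mono_on ?_ ?_ hS fun x hx => ?_
      · exact hi.add ((hintE hw2m hw2b).const_mul _)
      · refine hintE (by fun_prop) ⟨Real.exp 2, fun x hx => ?_⟩
        rw [abs_of_pos (Real.exp_pos _)]
        exact Real.exp_le_exp.2 ((neg_le_abs _).trans (hwb x hx))
      · have h4 := one_add_add_sq_div_four_le_exp (x := -w x) (by linarith [(abs_le.1 (hwb x hx)).2])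
        have h5 := mul_le_mul_of_nonneg_left h4 (Real.exp_pos (-φ₀ x)).le
        linarith
    rw [h2, integral_add hi ((hintE hw2m hw2b).const_mul _),
      integral_sub hi₀ (hintE hwm ⟨_, hwb⟩), integral_const_mul] at h3
    linarith
  have hlow : Real.exp (-2) * ∫ x in S, w x ^ 2 ∂ν ≤ ∫ x in S, Real.exp (-φ₀ x) * w x ^ 2 ∂ν := by
    rw [← integral_const_mul]
    refine setIntegral_mono_on ((hint hw2m hw2b).const_mul _) (hintE hw2m hw2b) hS fun x hx => ?_
    refine mul_le_mul_of_nonneg_right (Real.exp_le_exp.2 ?_) (sq_nonneg _)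
    linarith [(hb₀ x hx).2]
  have hsplit : ∀ x, φ₁ x - φ₀ x - (φ t x - φ₀ x) / t = w x - δ x / t := fun x => by
    simp only [hwdef, hδdef]; field_simp; ring
  have hδti : ∀ {f : E → ℝ}, f = (fun x => δ x / t) → Measurable f ∧ ∃ B, ∀ x ∈ S, |f x| ≤ B := by
    rintro f rfl
    refine ⟨hδm.div_const _, (M + 1), fun x hx => ?_⟩
    rw [abs_div, abs_of_pos ht0, div_le_iff₀ ht0]
    exact hδb x hx
  have hfinal : ∫ x in S, Real.exp (-φ₀ x) * (w x - δ x / t) ∂ν ≤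
      ∫ x in S, (φ₁ x - φ₀ x - (φ t x - φ₀ x) / t) ∂ν := by
    simp only [hsplit]
    refine setIntegral_mono_on ?_ ((hint hwm ⟨_, hwb⟩).sub (hint (hδti rfl).1 (hδti rfl).2)) hS
      fun x hx => ?_
    · simp only [mul_sub]
      exact (hintE hwm ⟨_, hwb⟩).sub (hintE (hδti rfl).1 (hδti rfl).2)
    · refine mul_le_of_le_one_left ?_ ((le_abs_self _).trans (hEb x hx))
      have := hφ t hmem x hx x hx
      rw [← add_smul, sub_add_cancel, one_smul] at this
      rw [← hsplit, sub_nonneg, div_le_iff₀ ht0]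
      linarith
  simp only [mul_sub] at hfinal
  rw [integral_sub (hintE hwm ⟨_, hwb⟩) (hintE (hδti rfl).1 (hδti rfl).2)] at hfinal
  simp only [← mul_div_assoc] at hfinal
  rw [integral_div] at hfinal
  have hdiv : (∫ x in S, Real.exp (-φ₀ x) * δ x ∂ν) / t ≤ (M + 1) ^ 2 * Z₀ * t := by
    rw [div_le_iff₀ ht0]
    linarith [hδE, show ((M + 1) * t) ^ 2 * Z₀ = (M + 1) ^ 2 * Z₀ * t * t by ring]
  linarith

theorem sub_le_oscOn {X : Type*} {Y : Set X} {v : X → ℝ} {M : ℝ} (hv : ∀ y ∈ Y, |v y| ≤ M)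
    {y y' : X} (hy : y ∈ Y) (hy' : y' ∈ Y) : v y - v y' ≤ oscOn Y v :=
  sub_le_sub
    (le_csSup ⟨M, by rintro _ ⟨z, hz, rfl⟩; exact (abs_le.1 (hv z hz)).2⟩ (mem_image_of_mem v hy))
    (csInf_le ⟨-M, by rintro _ ⟨z, hz, rfl⟩; exact (abs_le.1 (hv z hz)).1⟩
      (mem_image_of_mem v hy'))

section BoundaryCost

variable {X : Type*} [PseudoMetricSpace X]

/-- The quadratic boundary cost `b_Ω(x,y)²`, written without real powers. -/
def bcost (Ω : Set X) (x y : X) : ℝ :=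
  min (dist x y ^ 2) (infDist x Ωᶜ ^ 2 + infDist y Ωᶜ ^ 2)

theorem bdist_two_rpow_two (Ω : Set X) (x y : X) : bdist 2 Ω x y ^ (2 : ℝ) = bcost Ω x y := by
  have h : 0 ≤ infDist x Ωᶜ ^ 2 + infDist y Ωᶜ ^ 2 := by positivity
  simp only [bdist, bcost, Real.rpow_two, ← Real.sqrt_eq_rpow]
  rcases le_total (dist x y) √(infDist x Ωᶜ ^ 2 + infDist y Ωᶜ ^ 2) with h1 | h1
  · rw [min_eq_left h1, min_eq_left ((Real.le_sqrt dist_nonneg h).1 h1)]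
  · rw [min_eq_right h1, Real.sq_sqrt h, min_eq_right ((Real.sqrt_le_left dist_nonneg).1 h1)]

theorem bcost_nonneg (Ω : Set X) (x y : X) : 0 ≤ bcost Ω x y :=
  le_min (by positivity) (by positivity)

theorem bcost_le_dist_sq (Ω : Set X) (x y : X) : bcost Ω x y ≤ dist x y ^ 2 := min_le_left _ _

theorem continuous_bcost (Ω : Set X) : Continuous fun z : X × X => bcost Ω z.1 z.2 := by
  unfold bcost
  have h := continuous_infDist_pt Ωᶜ
  exact (continuous_dist.pow 2).min
    (((h.comp continuous_fst).pow 2).add ((h.comp continuous_snd).pow 2))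

theorem bcost_le_diam_sq {Ω : Set X} (hΩ : Bornology.IsBounded Ω) {x y : X} (hx : x ∈ closure Ω)
    (hy : y ∈ closure Ω) : bcost Ω x y ≤ diam Ω ^ 2 := by
  refine (bcost_le_dist_sq Ω x y).trans (pow_le_pow_left₀ dist_nonneg ?_ 2)
  rw [← diam_closure]
  exact dist_le_diam_of_mem hΩ.closure hx hy

theorem Qb_two (Ω Y : Set X) (v : X → ℝ) (x : X) :
    Qb 2 Ω Y v x = ⨅ y : Y, (v y + bcost Ω x y) := by
  simp only [Qb, bdist_two_rpow_two]

theorem Qb_congr {Ω Y : Set X} {v w : X → ℝ} (h : EqOn v w Y) : Qb 2 Ω Y v = Qb 2 Ω Y w := by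
  ext x
  simp only [Qb_two]
  exact iInf_congr fun y => by rw [h y.2]

variable {Ω Y : Set X} {v : X → ℝ} {M : ℝ}

theorem bddBelow_range_add_bcost (hv : ∀ y ∈ Y, |v y| ≤ M) (x : X) :
    BddBelow (range fun y : Y => v y + bcost Ω x y) := by
  refine ⟨-M, ?_⟩
  rintro _ ⟨y, rfl⟩
  linarith [(abs_le.1 (hv y y.2)).1, bcost_nonneg Ω x y]

theorem Qb_le (hv : ∀ y ∈ Y, |v y| ≤ M) (x : X) {y : X} (hy : y ∈ Y) :
    Qb 2 Ω Y v x ≤ v y + bcost Ω x y := by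
  rw [Qb_two]
  exact ciInf_le (bddBelow_range_add_bcost hv x) (⟨y, hy⟩ : Y)

theorem le_Qb (hY : Y.Nonempty) {x : X} {a : ℝ} (h : ∀ y ∈ Y, a ≤ v y + bcost Ω x y) :
    a ≤ Qb 2 Ω Y v x := by
  have := hY.to_subtype
  rw [Qb_two]
  exact le_ciInf fun y => h y y.2

theorem abs_Qb_le (hΩ : Bornology.IsBounded Ω) (hYΩ : Y ⊆ closure Ω) (hY : Y.Nonempty)
    (hv : ∀ y ∈ Y, |v y| ≤ M) {x : X} (hx : x ∈ Ω) : |Qb 2 Ω Y v x| ≤ M + diam Ω ^ 2 := by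
  rw [abs_le]
  constructor
  · refine le_Qb hY fun y hy => ?_
    nlinarith [(abs_le.1 (hv y hy)).1, bcost_nonneg Ω x y, sq_nonneg (diam Ω)]
  · obtain ⟨y, hy⟩ := hY
    linarith [Qb_le (Ω := Ω) hv x hy, (abs_le.1 (hv y hy)).2,
      bcost_le_diam_sq hΩ (subset_closure hx) (hYΩ hy)]

theorem measurable_Qb [MeasurableSpace X] [OpensMeasurableSpace X] (hv : ∀ y ∈ Y, |v y| ≤ M) :
    Measurable (Qb 2 Ω Y v) := by
  have : Qb 2 Ω Y v = fun x => ⨅ y : Y, (v y + bcost Ω x y) := funext (Qb_two Ω Y v)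
  rw [this]
  refine (upperSemicontinuous_ciInf (fun x => bddBelow_range_add_bcost hv x) fun y => ?_).measurable
  exact (continuous_const.add
    ((continuous_bcost Ω).comp (continuous_id.prodMk continuous_const))).upperSemicontinuous

/-- Functions in `S(b_Ω², Y)` are bounded and measurable on `Y`. -/
theorem memS.exists_measurable_bounded [MeasurableSpace X] [OpensMeasurableSpace X]
    (hΩ : Bornology.IsBounded Ω) (hYΩ : Y ⊆ closure Ω) (hv : memS 2 Ω (closure Ω) Y v) :
    ∃ w : X → ℝ, Measurable w ∧ EqOn v w Y ∧ ∃ M, ∀ y ∈ Y, |w y| ≤ M := by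
  obtain ⟨u, hu⟩ := hv
  have hQ : ∀ y, Qbhat 2 Ω (closure Ω) u y = ⨆ x : closure Ω, (u x - bcost Ω x y) := fun y => by
    simp only [Qbhat, bdist_two_rpow_two]
  by_cases hb : BddAbove (range fun x : closure Ω => u x)
  · obtain ⟨B, hB⟩ := hb
    have hB' : ∀ x : closure Ω, u x ≤ B := fun x => hB (mem_range_self x)
    have hbdd : ∀ y, BddAbove (range fun x : closure Ω => u x - bcost Ω x y) := fun y => by
      refine ⟨B, ?_⟩
      rintro _ ⟨x, rfl⟩
      linarith [hB' x, bcost_nonneg Ω x y]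
    refine ⟨Qbhat 2 Ω (closure Ω) u, ?_, hu, ?_⟩
    · rw [funext hQ]
      refine (lowerSemicontinuous_ciSup hbdd fun x => ?_).measurable
      exact (continuous_const.sub
        ((continuous_bcost Ω).comp (continuous_const.prodMk continuous_id))).lowerSemicontinuous
    · rcases (closure Ω).eq_empty_or_nonempty with h0 | ⟨x₀, hx₀⟩
      · exact ⟨0, fun y hy => by simpa [h0] using hYΩ hy⟩
      refine ⟨max B (diam Ω ^ 2 - u x₀), fun y hy => ?_⟩
      have : Nonempty (closure Ω) := ⟨⟨x₀, hx₀⟩⟩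
      rw [hQ, abs_le]
      constructor
      · have h1 := le_ciSup (hbdd y) ⟨x₀, hx₀⟩
        have h2 := bcost_le_diam_sq hΩ hx₀ (hYΩ hy)
        have h3 := le_max_right B (diam Ω ^ 2 - u x₀)
        simp only at h1
        linarith
      · exact (ciSup_le fun x => by linarith [hB' x, bcost_nonneg Ω x y]).trans (le_max_left _ _)
  · refine ⟨0, measurable_const, fun y hy => ?_, 0, fun y _ => by simp⟩
    rw [hu y hy, hQ, Real.iSup_of_not_bddAbove]
    · rfl
    · rintro ⟨B, hB⟩
      refine hb ⟨B + diam Ω ^ 2, ?_⟩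
      rintro _ ⟨x, rfl⟩
      have h1 := hB (mem_range_self x)
      have h2 := bcost_le_diam_sq hΩ x.2 (hYΩ hy)
      simp only at h1 ⊢
      linarith

/-- Deep inside `Ω` the infimum defining `Q(v)` is governed by the Euclidean cost. -/
theorem exists_add_dist_sq_le (hYc : IsCompact Y) (hY : Y.Nonempty) {O S r : ℝ} (hr : 0 ≤ r)
    (hv : ∀ y ∈ Y, ∀ y' ∈ Y, v y - v y' ≤ O) {x : X} (hxS : infDist x Y ≤ S)
    (hOS : O + S ^ 2 ≤ r ^ 2) (hx : r < infDist x Ωᶜ) {y' : X} (hy' : y' ∈ Y) :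
    ∃ y ∈ Y, v y + dist x y ^ 2 ≤ v y' + bcost Ω x y' := by
  rcases le_total (dist x y' ^ 2) (infDist x Ωᶜ ^ 2 + infDist y' Ωᶜ ^ 2) with h | h
  · exact ⟨y', hy', by rw [bcost, min_eq_left h]⟩
  · obtain ⟨y, hy, hxy⟩ := hYc.exists_infDist_eq_dist hY x
    refine ⟨y, hy, ?_⟩
    rw [bcost, min_eq_right h, ← hxy]
    have h1 : infDist x Y ^ 2 ≤ S ^ 2 := pow_le_pow_left₀ infDist_nonneg hxS 2
    have h2 : r ^ 2 ≤ infDist x Ωᶜ ^ 2 := pow_le_pow_left₀ hr hx.le 2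
    nlinarith [hv y hy y' hy', sq_nonneg (infDist y' Ωᶜ)]

theorem infDist_le_supInfDist (hΩ : Bornology.IsBounded Ω) (hYΩ : Y ⊆ closure Ω) {x : X}
    (hx : x ∈ closure Ω) : infDist x Y ≤ supInfDist (closure Ω) Y := by
  refine le_csSup ⟨diam Ω, ?_⟩ (mem_image_of_mem _ hx)
  rintro _ ⟨z, hz, rfl⟩
  rcases Y.eq_empty_or_nonempty with rfl | ⟨y, hy⟩
  · simp [diam_nonneg]
  · refine (infDist_le_dist_of_mem hy).trans ?_
    rw [← diam_closure]
    exact dist_le_diam_of_mem hΩ.closure hz (hYΩ hy)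

/-- Weak duality for the quadratic boundary transport cost. -/
theorem integral_Qb_sub_integral_le_Wb [SecondCountableTopology X] [MeasurableSpace X]
    [BorelSpace X] (hΩ : Bornology.IsBounded Ω) (hYΩ : Y ⊆ closure Ω)
    (hY : Y.Nonempty) (hvm : Measurable v) (hv : ∀ y ∈ Y, |v y| ≤ M) {μ lam : Measure X}
    [IsFiniteMeasure μ] [IsFiniteMeasure lam] (hμΩ : μ Ωᶜ = 0) (hlamΩ : lam Ωᶜ = 0)
    (hμY : μ Yᶜ = 0) (hmass : lam univ = μ univ) (hmass0 : μ univ ≠ 0) :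
    (∫ x, Qb 2 Ω Y v x ∂lam) - ∫ y in Y, v y ∂μ ≤ Wb 2 Ω μ lam := by
  have hμΩ' : ∀ᵐ y ∂μ, y ∈ Ω := hμΩ
  have hlamΩ' : ∀ᵐ x ∂lam, x ∈ Ω := hlamΩ
  have hμY' : ∀ᵐ y ∂μ, y ∈ Y := hμY
  have hcm : Measurable fun z : X × X => bcost Ω z.1 z.2 := (continuous_bcost Ω).measurable
  rw [Wb, Measure.restrict_eq_self_of_ae_mem hμΩ', Measure.restrict_eq_self_of_ae_mem hlamΩ',
    Measure.restrict_eq_self_of_ae_mem hμY', transportCost, transportCostE]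
  simp only [bdist_two_rpow_two]
  have hπ : ∀ π ∈ couplings μ lam, IsFiniteMeasure π ∧ (∀ᵐ z ∂π, z.1 ∈ Ω) ∧ (∀ᵐ z ∂π, z.2 ∈ Ω) ∧
      ∀ᵐ z ∂π, z.2 ∈ Y := by
    rintro π ⟨h1, h2⟩
    refine ⟨⟨?_⟩, ae_of_ae_map measurable_fst.aemeasurable (h1 ▸ hlamΩ'),
      ae_of_ae_map measurable_snd.aemeasurable (h2 ▸ hμΩ'),
      ae_of_ae_map measurable_snd.aemeasurable (h2 ▸ hμY')⟩
    have : π univ = lam univ := by rw [← h1, Measure.map_apply measurable_fst .univ, preimage_univ]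
    rw [this]
    exact measure_lt_top _ _
  have hci : ∀ π ∈ couplings μ lam, Integrable (fun z => bcost Ω z.1 z.2) π := fun π hπ' => by
    obtain ⟨_, h1, h2, -⟩ := hπ π hπ'
    refine Integrable.of_bound hcm.aestronglyMeasurable (diam Ω ^ 2) ?_
    filter_upwards [h1, h2] with z hz1 hz2
    rw [Real.norm_of_nonneg (bcost_nonneg _ _ _)]
    exact bcost_le_diam_sq hΩ (subset_closure hz1) (subset_closure hz2)
  have hlint : ∀ π ∈ couplings μ lam, ∫⁻ z, ENNReal.ofReal (bcost Ω z.1 z.2) ∂π =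
      ENNReal.ofReal (∫ z, bcost Ω z.1 z.2 ∂π) := fun π hπ' =>
    (ofReal_integral_eq_lintegral_ofReal (hci π hπ')
      (Eventually.of_forall fun z => bcost_nonneg _ _ _)).symm
  have hprod : (μ univ)⁻¹ • lam.prod μ ∈ couplings μ lam := by
    have hinv : (μ univ)⁻¹ * μ univ = 1 := ENNReal.inv_mul_cancel hmass0 (measure_ne_top _ _)
    constructor
    · rw [Measure.map_smul, Measure.map_fst_prod, smul_smul, hinv, one_smul]
    · rw [Measure.map_smul, Measure.map_snd_prod, hmass, smul_smul, hinv, one_smul]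
  have hfin : (⨅ π ∈ couplings μ lam, ∫⁻ z, ENNReal.ofReal (bcost Ω z.1 z.2) ∂π) ≠ ∞ :=
    ne_top_of_le_ne_top (by rw [hlint _ hprod]; exact ENNReal.ofReal_ne_top) (iInf₂_le _ hprod)
  rw [← ENNReal.ofReal_le_iff_le_toReal hfin]
  refine le_iInf₂ fun π hπ' => ?_
  rw [hlint π hπ']
  refine ENNReal.ofReal_le_ofReal ?_
  obtain ⟨_, h1, h2, h3⟩ := hπ π hπ'
  have hQi : Integrable (fun z : X × X => Qb 2 Ω Y v z.1) π := by
    refine Integrable.of_bound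
      ((measurable_Qb hv).comp measurable_fst).aestronglyMeasurable (M + diam Ω ^ 2) ?_
    filter_upwards [h1] with z hz using abs_Qb_le hΩ hYΩ hY hv hz
  have hvi : Integrable (fun z : X × X => v z.2) π := by
    refine Integrable.of_bound (hvm.comp measurable_snd).aestronglyMeasurable M ?_
    filter_upwards [h3] with z hz using hv _ hz
  rw [← hπ'.1, ← hπ'.2, integral_map measurable_fst.aemeasurable
    (measurable_Qb hv).aestronglyMeasurable, integral_map measurable_snd.aemeasurable
    hvm.aestronglyMeasurable, ← integral_sub hQi hvi]
  refine integral_mono_ae (hQi.sub hvi) (hci π hπ') ?_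
  filter_upwards [h3] with z hz
  linarith [Qb_le (Ω := Ω) hv z.1 hz]

end BoundaryCost

section InnerPart

variable {E : Type*} [SeminormedAddCommGroup E] {Ω : Set E} {r : ℝ}

theorem innerPart_eq (hr : 0 ≤ r) : innerPart Ω r = {x | r < infDist x Ωᶜ} := by
  ext x
  refine ⟨fun h => h.2, fun h => ⟨?_, h⟩⟩
  by_contra hx
  rw [Set.mem_ofPred_eq, infDist_zero_of_mem (show x ∈ Ωᶜ from hx)] at h
  linarith

theorem isOpen_innerPart (hr : 0 ≤ r) : IsOpen (innerPart Ω r) := by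
  rw [innerPart_eq hr]
  exact isOpen_lt continuous_const (continuous_infDist_pt _)

theorem convex_innerPart [NormedSpace ℝ E] (hΩ : Convex ℝ Ω) : Convex ℝ (innerPart Ω r) := by
  rintro x ⟨hx, hxr⟩ y ⟨hy, hyr⟩ a b ha hb hab
  refine ⟨hΩ hx hy ha hb hab, ?_⟩
  rcases Ωᶜ.eq_empty_or_nonempty with h0 | h0
  · simpa [h0] using hxr
  refine (lt_min hxr hyr).trans_le ((le_infDist h0).2 fun p hp => ?_)
  by_contra! hlt
  obtain ⟨hlx, hly⟩ := lt_min_iff.1 hlt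
  set e := p - (a • x + b • y) with he
  have hmem : ∀ z, dist (a • x + b • y) p < infDist z Ωᶜ → z + e ∈ Ω := fun z hz => by
    by_contra hze
    refine (infDist_le_dist_of_mem (x := z) (show z + e ∈ Ωᶜ from hze)).not_gt ?_
    rwa [dist_self_add_right, he, ← dist_eq_norm, dist_comm]
  refine hp ?_
  have : p = a • (x + e) + b • (y + e) := by
    rw [smul_add, smul_add, add_add_add_comm, ← add_smul, hab, one_smul, he]
    abel
  rw [this]
  exact hΩ (hmem x hlx) (hmem y hly) ha hb hab

end InnerPart

theorem norm_convexCombination_sub_sq {E : Type*} [NormedAddCommGroup E] [InnerProductSpace ℝ E]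
    (t : ℝ) (x y c : E) : ‖(1 - t) • x + t • y - c‖ ^ 2 =
      (1 - t) * ‖x - c‖ ^ 2 + t * ‖y - c‖ ^ 2 - t * (1 - t) * ‖x - y‖ ^ 2 := by
  have h1 : (1 - t) • x + t • y - c = (1 - t) • (x - c) + t • (y - c) := by module
  have h2 : x - y = (x - c) - (y - c) := by abel
  rw [h1, h2, norm_add_sq_real, norm_sub_sq_real (x - c), norm_smul, norm_smul, inner_smul_left,
    inner_smul_right, mul_pow, mul_pow, Real.norm_eq_abs, Real.norm_eq_abs, sq_abs, sq_abs]
  simp only [conj_trivial]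
  ring

/-- Along the segment from `v` to `w`, the functions `|·|² - Q(v_t)` are jointly convex where the
cost is Euclidean. -/
theorem le_Qb_convexCombination {E : Type*} [NormedAddCommGroup E] [InnerProductSpace ℝ E]
    {Ω Y : Set E} {v w : E → ℝ} {M O S r t : ℝ} (hYc : IsCompact Y) (hY : Y.Nonempty) (hr : 0 ≤ r)
    (hv : ∀ y ∈ Y, |v y| ≤ M) (hw : ∀ y ∈ Y, |w y| ≤ M)
    (hvO : ∀ y ∈ Y, ∀ y' ∈ Y, v y - v y' ≤ O) (hwO : ∀ y ∈ Y, ∀ y' ∈ Y, w y - w y' ≤ O)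
    (hOS : O + S ^ 2 ≤ r ^ 2) (ht : t ∈ Ioo (0 : ℝ) 1) {x y : E} (c : E)
    (hzS : infDist ((1 - t) • x + t • y) Y ≤ S) (hz : r < infDist ((1 - t) • x + t • y) Ωᶜ) :
    (1 - t) * (Qb 2 Ω Y v x - ‖x - c‖ ^ 2) + t * (Qb 2 Ω Y w y - ‖y - c‖ ^ 2)
        + ‖(1 - t) • x + t • y - c‖ ^ 2 ≤
      Qb 2 Ω Y (fun y => (1 - t) * v y + t * w y) ((1 - t) • x + t • y) := by
  obtain ⟨ht0, ht1⟩ := ht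
  refine le_Qb hY fun y' hy' => ?_
  obtain ⟨q, hq, hle⟩ := exists_add_dist_sq_le (v := fun y => (1 - t) * v y + t * w y) hYc hY hr
    (fun y hy y' hy' => by nlinarith [hvO y hy y' hy', hwO y hy y' hy']) hzS hOS hz hy'
  refine le_trans ?_ hle
  have h1 := (Qb_le (Ω := Ω) hv x hq).trans (add_le_add le_rfl (bcost_le_dist_sq Ω x q))
  have h2 := (Qb_le (Ω := Ω) hw y hq).trans (add_le_add le_rfl (bcost_le_dist_sq Ω y q))
  rw [dist_eq_norm] at h1 h2 ⊢
  rw [norm_convexCombination_sub_sq, norm_convexCombination_sub_sq]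
  nlinarith [mul_le_mul_of_nonneg_left h1 (sub_nonneg.2 ht1.le),
    mul_le_mul_of_nonneg_left h2 ht0.le]

theorem convexCombination_Qb_le {X : Type*} [PseudoMetricSpace X] {Ω Y : Set X} {v w : X → ℝ}
    {M t : ℝ} (hY : Y.Nonempty) (hv : ∀ y ∈ Y, |v y| ≤ M) (hw : ∀ y ∈ Y, |w y| ≤ M)
    (ht : t ∈ Ioo (0 : ℝ) 1) (x : X) :
    (1 - t) * Qb 2 Ω Y v x + t * Qb 2 Ω Y w x ≤ Qb 2 Ω Y (fun y => (1 - t) * v y + t * w y) x :=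
  le_Qb hY fun y hy => by
    nlinarith [mul_le_mul_of_nonneg_left (Qb_le (Ω := Ω) hv x hy) (sub_nonneg.2 ht.2.le),
      mul_le_mul_of_nonneg_left (Qb_le (Ω := Ω) hw x hy) ht.1.le]

theorem Qb_le_Qb_add {X : Type*} [PseudoMetricSpace X] {Ω Y : Set X} {v w : X → ℝ} {M δ : ℝ}
    (hY : Y.Nonempty) (hv : ∀ y ∈ Y, |v y| ≤ M) (h : ∀ y ∈ Y, v y ≤ w y + δ) (x : X) :
    Qb 2 Ω Y v x ≤ Qb 2 Ω Y w x + δ :=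
  sub_le_iff_le_add.1 (le_Qb hY fun y hy => by linarith [h y hy, Qb_le (Ω := Ω) hv x hy])

theorem abs_convexCombination_le {v w M t : ℝ} (hv : |v| ≤ M) (hw : |w| ≤ M)
    (ht : t ∈ Ioo (0 : ℝ) 1) : |(1 - t) * v + t * w| ≤ M := by
  rw [abs_le] at *
  constructor <;> nlinarith [ht.1, ht.2]

theorem sInf_le_Qb {X : Type*} [PseudoMetricSpace X] {Ω Y : Set X} {v : X → ℝ} {M : ℝ}
    (hY : Y.Nonempty) (hv : ∀ y ∈ Y, |v y| ≤ M) (x : X) : sInf (v '' Y) ≤ Qb 2 Ω Y v x :=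
  le_Qb hY fun y hy => by
    have := csInf_le ⟨-M, by rintro _ ⟨z, hz, rfl⟩; exact (abs_le.1 (hv z hz)).1⟩
      (mem_image_of_mem v hy)
    linarith [bcost_nonneg Ω x y]

theorem Qb_le_sInf_add {X : Type*} [PseudoMetricSpace X] {Ω Y : Set X} {v : X → ℝ} {M : ℝ}
    (hΩ : Bornology.IsBounded Ω) (hYΩ : Y ⊆ closure Ω) (hY : Y.Nonempty)
    (hv : ∀ y ∈ Y, |v y| ≤ M) {x : X} (hx : x ∈ Ω) :
    Qb 2 Ω Y v x ≤ sInf (v '' Y) + diam Ω ^ 2 := by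
  rw [← sub_le_iff_le_add]
  refine le_csInf (hY.image v) ?_
  rintro _ ⟨y, hy, rfl⟩
  linarith [Qb_le (Ω := Ω) hv x hy, bcost_le_diam_sq hΩ (subset_closure hx) (hYΩ hy)]

/-- The dual deficit of `w` with respect to an optimizer `v` controls the defect of linearity of
`t ↦ Q((1 - t) v + t w)` at the origin. -/
theorem integral_linearization_le_deficit {X : Type*} [PseudoMetricSpace X]
    [SecondCountableTopology X] [MeasurableSpace X] [BorelSpace X] {Ω Y : Set X} {v w : X → ℝ}
    {M t : ℝ} (hΩ : Bornology.IsBounded Ω) (hYΩ : Y ⊆ closure Ω)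
    (hY : Y.Nonempty) (hvm : Measurable v) (hwm : Measurable w) (hv : ∀ y ∈ Y, |v y| ≤ M)
    (hw : ∀ y ∈ Y, |w y| ≤ M) {μ lam : Measure X} [IsFiniteMeasure μ] [IsFiniteMeasure lam]
    (hμΩ : μ Ωᶜ = 0) (hlamΩ : lam Ωᶜ = 0) (hμY : μ Yᶜ = 0) (hmass : lam univ = μ univ)
    (hmass0 : μ univ ≠ 0) (ht : t ∈ Ioo (0 : ℝ) 1)
    (hopt : (∫ x, Qb 2 Ω Y v x ∂lam) - ∫ y in Y, v y ∂μ = Wb 2 Ω μ lam) :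
    Integrable (fun x => Qb 2 Ω Y v x - Qb 2 Ω Y w x
        + (Qb 2 Ω Y (fun y => (1 - t) * v y + t * w y) x - Qb 2 Ω Y v x) / t) lam ∧
    ∫ x, (Qb 2 Ω Y v x - Qb 2 Ω Y w x
        + (Qb 2 Ω Y (fun y => (1 - t) * v y + t * w y) x - Qb 2 Ω Y v x) / t) ∂lam ≤
      Wb 2 Ω μ lam - ((∫ x, Qb 2 Ω Y w x ∂lam) - ∫ y in Y, w y ∂μ) := by
  have hlamΩ' : ∀ᵐ x ∂lam, x ∈ Ω := hlamΩ
  have hμY' : ∀ᵐ y ∂μ, y ∈ Y := hμY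
  have hs : ∀ y ∈ Y, |(1 - t) * v y + t * w y| ≤ M := fun y hy =>
    abs_convexCombination_le (hv y hy) (hw y hy) ht
  have hQi : ∀ {f : X → ℝ}, (∀ y ∈ Y, |f y| ≤ M) → Integrable (Qb 2 Ω Y f) lam := fun hf =>
    Integrable.of_bound (measurable_Qb hf).aestronglyMeasurable (M + diam Ω ^ 2)
      (hlamΩ'.mono fun x hx => abs_Qb_le hΩ hYΩ hY hf hx)
  have hi : ∀ {f : X → ℝ}, Measurable f → (∀ y ∈ Y, |f y| ≤ M) → Integrable f μ := fun hfm hf =>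
    Integrable.of_bound hfm.aestronglyMeasurable M (hμY'.mono fun y hy => hf y hy)
  have key := integral_Qb_sub_integral_le_Wb hΩ hYΩ hY
    ((hvm.const_mul (1 - t)).add (hwm.const_mul t)) hs hμΩ hlamΩ hμY hmass hmass0
  rw [← hopt] at key ⊢
  rw [Measure.restrict_eq_self_of_ae_mem hμY'] at key ⊢
  simp only [Pi.add_apply] at key
  rw [integral_add ((hi hvm hv).const_mul _) ((hi hwm hw).const_mul _), integral_const_mul,
    integral_const_mul] at key
  refine ⟨((hQi hv).sub (hQi hw)).add (((hQi hs).sub (hQi hv)).div_const t), ?_⟩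
  have h1 : ∫ x, (Qb 2 Ω Y v x - Qb 2 Ω Y w x
        + (Qb 2 Ω Y (fun y => (1 - t) * v y + t * w y) x - Qb 2 Ω Y v x) / t) ∂lam =
      (∫ x, Qb 2 Ω Y v x ∂lam) - (∫ x, Qb 2 Ω Y w x ∂lam) +
        ((∫ x, Qb 2 Ω Y (fun y => (1 - t) * v y + t * w y) x ∂lam) - ∫ x, Qb 2 Ω Y v x ∂lam) / t := by
    rw [← integral_sub (hQi hv) (hQi hw), ← integral_sub (hQi hs) (hQi hv), ← integral_div]
    exact integral_add ((hQi hv).sub (hQi hw)) (((hQi hs).sub (hQi hv)).div_const t)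
  have h2 : ((∫ x, Qb 2 Ω Y (fun y => (1 - t) * v y + t * w y) x ∂lam)
      - ∫ x, Qb 2 Ω Y v x ∂lam) / t ≤ (∫ y, w y ∂μ) - ∫ y, v y ∂μ := by
    rw [div_le_iff₀ ht.1]
    change (∫ x, Qb 2 Ω Y (fun y => (1 - t) * v y + t * w y) x ∂lam) - _ ≤ _ at key
    linarith
  rw [h1]
  linarith

theorem VarOn_le {d : ℕ} (E : Set (EuclideanSpace ℝ (Fin d))) (f : EuclideanSpace ℝ (Fin d) → ℝ)
    (a : ℝ) : VarOn E f ≤ ∫ x in E, (f x - a) ^ 2 :=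
  ciInf_le ⟨0, by rintro _ ⟨b, rfl⟩; exact integral_nonneg fun x => sq_nonneg _⟩ a

theorem VarOn_eq_zero_of_null {d : ℕ} {E : Set (EuclideanSpace ℝ (Fin d))} (hE : volume E = 0)
    (f : EuclideanSpace ℝ (Fin d) → ℝ) : VarOn E f = 0 := by
  simp [VarOn, Measure.restrict_eq_zero.2 hE]

theorem VarOn_le_of_linearization_le {d : ℕ} {Ω Y : Set (EuclideanSpace ℝ (Fin d))}
    {v w : EuclideanSpace ℝ (Fin d) → ℝ} {M r A : ℝ} (hΩc : Convex ℝ Ω)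
    (hΩ : Bornology.IsBounded Ω) (hYΩ : Y ⊆ closure Ω) (hYc : IsCompact Y) (hY : Y.Nonempty)
    (hv : ∀ y ∈ Y, |v y| ≤ M) (hw : ∀ y ∈ Y, |w y| ≤ M) (hr : 0 ≤ r)
    (hOr : max (oscOn Y v) (oscOn Y w) + supInfDist (closure Ω) Y ^ 2 ≤ r ^ 2)
    (hE : (innerPart Ω r).Nonempty) (hD : 0 < diam Ω)
    (hA : ∀ t ∈ Ioo (0 : ℝ) 1, ∫ x in innerPart Ω r, (Qb 2 Ω Y v x - Qb 2 Ω Y w x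
        + (Qb 2 Ω Y (fun y => (1 - t) * v y + t * w y) x - Qb 2 Ω Y v x) / t) ≤ A) :
    VarOn (innerPart Ω r) (fun x => Qb 2 Ω Y v x - Qb 2 Ω Y w x) ≤
      4 * Real.exp 2 * diam Ω ^ 2 * A := by
  have hEΩ : innerPart Ω r ⊆ Ω := sep_subset _ _
  have hEo := isOpen_innerPart (Ω := Ω) hr
  have hEc := convex_innerPart (r := r) hΩc
  obtain ⟨x₀, hx₀⟩ := hE
  have hM : 0 ≤ M := (abs_nonneg _).trans (hv _ hY.some_mem)
  have hD2 : 0 < diam Ω ^ 2 := by positivity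
  set D := diam Ω
  set m := sInf (v '' Y)
  set m' := sInf (w '' Y)
  set q : ℝ → EuclideanSpace ℝ (Fin d) → ℝ :=
    fun t => Qb 2 Ω Y fun y => (1 - t) * v y + t * w y with hq
  have hqm : ∀ t, Measurable (q t) := fun t => by
    refine measurable_Qb (M := |1 - t| * M + |t| * M) fun y hy => (abs_add_le _ _).trans ?_
    rw [abs_mul, abs_mul]
    gcongr
    exacts [hv y hy, hw y hy]
  have hvm : Measurable (Qb 2 Ω Y v) := measurable_Qb hv
  have hwm : Measurable (Qb 2 Ω Y w) := measurable_Qb hw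
  have hnm : Measurable fun x : EuclideanSpace ℝ (Fin d) => ‖x - x₀‖ ^ 2 := by fun_prop
  have hn : ∀ x ∈ innerPart Ω r, ‖x - x₀‖ ^ 2 ≤ D ^ 2 := fun x hx => by
    rw [← dist_eq_norm]
    exact pow_le_pow_left₀ dist_nonneg (dist_le_diam_of_mem hΩ (hEΩ hx) (hEΩ hx₀)) 2
  have hlv := fun x => sInf_le_Qb (Ω := Ω) hY hv x
  have hlw := fun x => sInf_le_Qb (Ω := Ω) hY hw x
  have huv := fun x (hx : x ∈ innerPart Ω r) => Qb_le_sInf_add hΩ hYΩ hY hv (hEΩ hx)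
  have huw := fun x (hx : x ∈ innerPart Ω r) => Qb_le_sInf_add hΩ hYΩ hY hw (hEΩ hx)
  have hqv : ∀ t ∈ Ioo (0 : ℝ) 1, ∀ x, |Qb 2 Ω Y v x - q t x| ≤ 2 * M * t := fun t ht x => by
    rw [abs_le]
    have h1 := Qb_le_Qb_add (Ω := Ω) (w := fun y => (1 - t) * v y + t * w y) (δ := 2 * M * t)
      hY hv (fun y hy => by
        nlinarith [(abs_le.1 (hv y hy)).2, (abs_le.1 (hw y hy)).1, ht.1]) x
    have h2 := Qb_le_Qb_add (Ω := Ω) (v := fun y => (1 - t) * v y + t * w y) (w := v)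
      (δ := 2 * M * t) hY (fun y hy => abs_convexCombination_le (hv y hy) (hw y hy) ht)
      (fun y hy => by
        nlinarith [(abs_le.1 (hv y hy)).1, (abs_le.1 (hw y hy)).2, ht.1]) x
    constructor <;> simp only [hq] <;> linarith
  obtain ⟨k, K, hkK⟩ := (isPrekopaLeindler_volume_euclideanSpace d).exists_variance_le
    (S := innerPart Ω r) hEo.measurableSet hEc (hEo.measure_pos _ ⟨x₀, hx₀⟩).ne'
    (hΩ.subset hEΩ).measure_lt_top.ne
    (φ₀ := fun x => (‖x - x₀‖ ^ 2 - Qb 2 Ω Y v x + m + D ^ 2) / D ^ 2)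
    (φ₁ := fun x => (‖x - x₀‖ ^ 2 - Qb 2 Ω Y w x + m' + D ^ 2) / D ^ 2)
    (φ := fun t x => (‖x - x₀‖ ^ 2 - q t x + ((1 - t) * m + t * m') + D ^ 2) / D ^ 2)
    ((((hnm.sub hvm).add_const _).add_const _).div_const _)
    ((((hnm.sub hwm).add_const _).add_const _).div_const _)
    (fun t => (((hnm.sub (hqm t)).add_const _).add_const _).div_const _)
    (M := (2 * M + |m' - m|) / D ^ 2) (by positivity)
    (fun x hx => ⟨div_nonneg (by nlinarith [huv x hx]) hD2.le,
      (div_le_iff₀ hD2).2 (by linarith [hn x hx, hlv x])⟩)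
    (fun x hx => by
      rw [← sub_div, abs_div, abs_of_pos hD2, div_le_one hD2, abs_le]
      constructor <;> linarith [hlv x, hlw x, huv x hx, huw x hx])
    (fun t ht x _ => by
      rw [← sub_div, abs_div, abs_of_pos hD2, div_mul_eq_mul_div]
      refine div_le_div_of_nonneg_right ?_ hD2.le
      have h1 : ‖x - x₀‖ ^ 2 - q t x + ((1 - t) * m + t * m') + D ^ 2 -
          (‖x - x₀‖ ^ 2 - Qb 2 Ω Y v x + m + D ^ 2) =
          (Qb 2 Ω Y v x - q t x) + (m' - m) * t := by ring
      rw [h1, add_mul]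
      refine (abs_add_le _ _).trans (add_le_add (hqv t ht x) ?_)
      rw [abs_mul, abs_of_pos ht.1])
    (fun t ht x hx y hy => by
      have hz := hEc hx hy (sub_nonneg.2 ht.2.le) ht.1.le (sub_add_cancel 1 t)
      have h1 := le_Qb_convexCombination hYc hY hr hv hw
        (fun y hy y' hy' => (sub_le_oscOn hv hy hy').trans (le_max_left _ _))
        (fun y hy y' hy' => (sub_le_oscOn hw hy hy').trans (le_max_right _ _)) hOr ht x₀
        (infDist_le_supInfDist hΩ hYΩ (subset_closure (hEΩ hz))) hz.2
      rw [mul_div_assoc', mul_div_assoc', ← add_div]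
      refine div_le_div_of_nonneg_right ?_ hD2.le
      linarith)
  have key : Real.exp (-2) / 4 *
      ((∫ x in innerPart Ω r, (Qb 2 Ω Y v x - Qb 2 Ω Y w x - -(m' - m + k * D ^ 2)) ^ 2)
        / (D ^ 2) ^ 2) ≤ A / D ^ 2 := by
    have hlim : Tendsto (fun t : ℝ => A / D ^ 2 + K * t) (𝓝[>] 0) (𝓝 (A / D ^ 2)) := by
      refine tendsto_nhdsWithin_of_tendsto_nhds ?_
      have : Continuous fun t : ℝ => A / D ^ 2 + K * t := by fun_prop
      simpa using this.tendsto 0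
    refine ge_of_tendsto hlim ?_
    filter_upwards [hkK, Ioo_mem_nhdsGT (zero_lt_one' ℝ)] with t ht ht01
    rw [← integral_div]
    refine le_trans (le_of_eq ?_) (ht.trans (add_le_add_left ?_ _))
    · congr 1
      refine integral_congr_ae (Eventually.of_forall fun x => ?_)
      simp only
      field_simp
      ring
    · refine le_trans (le_of_eq ?_) (div_le_div_of_nonneg_right (hA t ht01) hD2.le)
      rw [← integral_div]
      refine integral_congr_ae (Eventually.of_forall fun x => ?_)
      have := ht01.1.ne'
      simp only [hq]
      field_simp
      ring
  refine (VarOn_le _ _ (-(m' - m + k * D ^ 2))).trans ?_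
  rw [Real.exp_neg] at key
  have he := Real.exp_pos 2
  field_simp at key
  linarith

theorem VarOn_le_deficit {d : ℕ} {Ω Y : Set (EuclideanSpace ℝ (Fin d))}
    {v w : EuclideanSpace ℝ (Fin d) → ℝ} {M ℓ : ℝ} (hΩc : Convex ℝ Ω)
    (hΩ : Bornology.IsBounded Ω) (hYΩ : Y ⊆ closure Ω) (hYc : IsCompact Y) (hY : Y.Nonempty)
    (hvm : Measurable v) (hwm : Measurable w)
    (hv : ∀ y ∈ Y, |v y| ≤ M) (hw : ∀ y ∈ Y, |w y| ≤ M)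
    {μ lam : Measure (EuclideanSpace ℝ (Fin d))} [IsFiniteMeasure μ]
    (hμΩ : μ Ωᶜ = 0) (hμY : μ Yᶜ = 0) (hΩ0 : volume Ω ≠ 0)
    (hμ : (volume Ω).toReal / 2 ≤ (μ Ω).toReal)
    (hlam : lam = (μ Ω / volume Ω) • volume.restrict Ω)
    (hopt : (∫ x, Qb 2 Ω Y v x ∂lam) - ∫ y in Y, v y ∂μ = Wb 2 Ω μ lam)
    (hℓ : ℓ = (max (oscOn Y v) (oscOn Y w) + supInfDist (closure Ω) Y ^ 2) ^ (1 / 2 : ℝ)) :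
    VarOn (innerPart Ω (3 * ℓ)) (fun x => Qb 2 Ω Y v x - Qb 2 Ω Y w x) ≤
      8 * Real.exp 2 * diam Ω ^ 2 *
        (Wb 2 Ω μ lam - ((∫ x in Ω, Qb 2 Ω Y w x ∂lam) - ∫ y in Y, w y ∂μ)) := by
  have hΩt : volume Ω ≠ ∞ := hΩ.measure_lt_top.ne
  have hvol : 0 < (volume Ω).toReal := ENNReal.toReal_pos hΩ0 hΩt
  have hμΩ0 : μ Ω ≠ 0 := fun h => by rw [h, ENNReal.toReal_zero] at hμ; linarith
  have hc0 : μ Ω / volume Ω ≠ 0 := ENNReal.div_ne_zero.2 ⟨hμΩ0, hΩt⟩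
  have hct : μ Ω / volume Ω ≠ ∞ := ENNReal.div_ne_top (measure_ne_top _ _) hΩ0
  have hc : 1 / 2 ≤ (μ Ω / volume Ω).toReal := by
    rw [ENNReal.toReal_div, le_div_iff₀ hvol]
    linarith
  have hΩm : NullMeasurableSet Ω (volume : Measure (EuclideanSpace ℝ (Fin d))) :=
    hΩc.nullMeasurableSet _
  have hmass : lam univ = μ univ := by
    rw [hlam, Measure.smul_apply, Measure.restrict_apply_univ, smul_eq_mul,
      ENNReal.div_mul_cancel hΩ0 hΩt]
    exact (measure_congr (eventuallyEq_univ.2 (show ∀ᵐ x ∂μ, x ∈ Ω from hμΩ)))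
  have : IsFiniteMeasure lam := ⟨hmass ▸ measure_lt_top _ _⟩
  have hlamΩ : lam Ωᶜ = 0 := by
    rw [hlam, Measure.smul_apply, Measure.restrict_apply₀' hΩm]
    simp
  have hmass0 : μ univ ≠ 0 := fun h => hμΩ0 (measure_mono_null (subset_univ _) h)
  rw [Measure.restrict_eq_self_of_ae_mem (show ∀ᵐ x ∂lam, x ∈ Ω from hlamΩ)]
  have hdef : 0 ≤ Wb 2 Ω μ lam - ((∫ x, Qb 2 Ω Y w x ∂lam) - ∫ y in Y, w y ∂μ) :=
    sub_nonneg.2 (integral_Qb_sub_integral_le_Wb hΩ hYΩ hY hwm hw hμΩ hlamΩ hμY hmass hmass0)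
  rcases (innerPart Ω (3 * ℓ)).eq_empty_or_nonempty with hE | hE
  · rw [VarOn_eq_zero_of_null (by rw [hE, measure_empty])]
    positivity
  rcases (diam_nonneg (s := Ω)).eq_or_lt with hD | hD
  · obtain ⟨x₀, hx₀⟩ := hE
    rw [← hD]
    refine (VarOn_le _ _ (Qb 2 Ω Y v x₀ - Qb 2 Ω Y w x₀)).trans (le_of_eq ?_)
    have hsub : innerPart Ω (3 * ℓ) ⊆ {x₀} := fun x hx => by
      refine dist_le_zero.1 ?_
      rw [hD]
      exact dist_le_diam_of_mem hΩ hx.1 hx₀.1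
    rw [show innerPart Ω (3 * ℓ) = {x₀} from hsub.antisymm (singleton_subset_iff.2 hx₀)]
    simp
  set O := max (oscOn Y v) (oscOn Y w) with hO
  have hO0 : 0 ≤ O := by
    obtain ⟨y, hy⟩ := hY
    have := sub_le_oscOn hv hy hy
    rw [sub_self] at this
    exact this.trans (le_max_left _ _)
  have hL0 : 0 ≤ O + supInfDist (closure Ω) Y ^ 2 := by positivity
  rw [← Real.sqrt_eq_rpow] at hℓ
  have hℓ0 : 0 ≤ ℓ := hℓ ▸ Real.sqrt_nonneg _
  have hℓ2 : ℓ ^ 2 = O + supInfDist (closure Ω) Y ^ 2 := by rw [hℓ, Real.sq_sqrt hL0]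
  have hfin := VarOn_le_of_linearization_le (r := 3 * ℓ) hΩc hΩ hYΩ hYc hY hv hw (by positivity)
    (by nlinarith) hE hD
    (A := 2 * (Wb 2 Ω μ lam - ((∫ x, Qb 2 Ω Y w x ∂lam) - ∫ y in Y, w y ∂μ))) fun t ht => by
      obtain ⟨hi, hle⟩ := integral_linearization_le_deficit hΩ hYΩ hY hvm hwm hv hw hμΩ hlamΩ hμY
        hmass hmass0 ht hopt
      have h0 : ∀ x, 0 ≤ Qb 2 Ω Y v x - Qb 2 Ω Y w x
          + (Qb 2 Ω Y (fun y => (1 - t) * v y + t * w y) x - Qb 2 Ω Y v x) / t := fun x => by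
        have h1 := convexCombination_Qb_le (Ω := Ω) hY hv hw ht x
        have h2 : Qb 2 Ω Y w x - Qb 2 Ω Y v x ≤
            (Qb 2 Ω Y (fun y => (1 - t) * v y + t * w y) x - Qb 2 Ω Y v x) / t := by
          rw [le_div_iff₀ ht.1]
          linarith
        linarith
      refine le_trans ?_ (mul_le_mul_of_nonneg_left hle zero_le_two)
      rw [hlam] at hi ⊢
      rw [integrable_smul_measure hc0 hct] at hi
      rw [integral_smul_measure, smul_eq_mul]
      have h3 := setIntegral_mono_set hi (Eventually.of_forall h0)
        (show innerPart Ω (3 * ℓ) ⊆ Ω from sep_subset _ _).eventuallyLE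
      refine h3.trans ?_
      have h4 := integral_nonneg_of_ae (μ := volume.restrict Ω) (Eventually.of_forall h0)
      linarith [mul_le_mul_of_nonneg_right hc h4]
  linarith

theorem oscOn_congr {X : Type*} {Y : Set X} {v w : X → ℝ} (h : EqOn v w Y) :
    oscOn Y v = oscOn Y w := by
  rw [oscOn, oscOn, h.image_eq]

theorem Wb_zero {X : Type*} [MeasurableSpace X] [PseudoMetricSpace X] (p : ℝ) (Ω : Set X) :
    Wb p Ω 0 0 = 0 := by
  have : transportCostE (fun x y => bdist p Ω x y ^ p) (0 : Measure X) 0 = 0 :=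
    le_antisymm ((iInf₂_le 0 ⟨Measure.map_zero _, Measure.map_zero _⟩).trans (by simp)) zero_le
  simp [Wb, transportCost, this]

/-- stability of Kantorovich potentials, Theorem 3.9: there is `C = C(d)`
such that for every bounded convex `Ω`, every `μ` supported on `Y ⊆ cl Ω` with
`1/2 ≤ μ(Ω)/|Ω| ≤ 2` and `λ := (μ(Ω)/|Ω|)χ_Ω`, every dual optimizer `v ∈ S(b_Ω², Y)` of
`Wb²_Ω(μ,λ)` and every `ṽ ∈ S(b_Ω², Y)`, with `u := Q(v)`, `ũ := Q(ṽ)` and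
`ℓ := (max{osc_Y v, osc_Y ṽ} + d(cl Ω, Y)²)^{1/2}`,
`Var_{Ω^{(3ℓ)}}(u − ũ) ≤ C diam(Ω)² [Wb²_Ω(μ,λ) − (∫_Ω ũ dλ − ∫_Y ṽ dμ)]`. -/
theorem stability_of_potentials (d : ℕ) :
    ∃ C : ℝ, 0 < C ∧
    ∀ (Ω : Set (EuclideanSpace ℝ (Fin d))), Convex ℝ Ω → Bornology.IsBounded Ω →
    ∀ (μ : Measure (EuclideanSpace ℝ (Fin d))), IsFiniteMeasure μ → μ Ωᶜ = 0 →
    ∀ Y : Set (EuclideanSpace ℝ (Fin d)), IsClosed Y → Y ⊆ closure Ω → μ Yᶜ = 0 →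
      (volume Ω).toReal / 2 ≤ (μ Ω).toReal → (μ Ω).toReal ≤ 2 * (volume Ω).toReal →
    ∀ lam : Measure (EuclideanSpace ℝ (Fin d)), lam = (μ Ω / volume Ω) • volume.restrict Ω →
    ∀ v : EuclideanSpace ℝ (Fin d) → ℝ, IsDualOpt 2 Ω (closure Ω) Y v μ lam →
    ∀ vt : EuclideanSpace ℝ (Fin d) → ℝ, memS 2 Ω (closure Ω) Y vt →
    ∀ ℓ : ℝ, ℓ = (max (oscOn Y v) (oscOn Y vt) + supInfDist (closure Ω) Y ^ 2) ^ (1/2 : ℝ) →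
      VarOn (innerPart Ω (3 * ℓ)) (fun x => Qb 2 Ω Y v x - Qb 2 Ω Y vt x) ≤
        C * diam Ω ^ 2 *
          (Wb 2 Ω μ lam - ((∫ x in Ω, Qb 2 Ω Y vt x ∂lam) - ∫ y in Y, vt y ∂μ)) := by
  refine ⟨8 * Real.exp 2, by positivity, ?_⟩
  intro Ω hΩc hΩ μ _ hμΩ Y hYcl hYΩ hμY hμ1 hμ2 lam hlam v hopt vt hvt ℓ hℓ
  have hYc : IsCompact Y := hΩ.isCompact_closure.of_isClosed_subset hYcl hYΩ
  by_cases hΩ0 : volume Ω = 0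
  · have hμ0 : μ = 0 := by
      rw [← Measure.measure_univ_eq_zero, ← union_compl_self Ω]
      refine measure_union_null ?_ hμΩ
      rw [hΩ0, ENNReal.toReal_zero, mul_zero] at hμ2
      exact ((ENNReal.toReal_eq_zero_iff _).1 (le_antisymm hμ2 ENNReal.toReal_nonneg)).resolve_right
        (measure_ne_top _ _)
    have hlam0 : lam = 0 := by rw [hlam, Measure.restrict_eq_zero.2 hΩ0, smul_zero]
    rw [VarOn_eq_zero_of_null (measure_mono_null (show innerPart Ω (3 * ℓ) ⊆ Ω from sep_subset _ _) hΩ0), hμ0, hlam0, Wb_zero]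
    simp
  have hY : Y.Nonempty := by
    rw [nonempty_iff_ne_empty]
    rintro rfl
    rw [compl_empty] at hμY
    rw [measure_mono_null (subset_univ Ω) hμY, ENNReal.toReal_zero] at hμ1
    linarith [ENNReal.toReal_pos hΩ0 hΩ.measure_lt_top.ne]
  obtain ⟨hvS, hopt⟩ := hopt
  obtain ⟨g, hgm, hvg, B, hgB⟩ := hvS.exists_measurable_bounded hΩ hYΩ
  obtain ⟨gt, hgtm, hvgt, Bt, hgtB⟩ := hvt.exists_measurable_bounded hΩ hYΩ
  rw [oscOn_congr hvg, oscOn_congr hvgt] at hℓ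
  rw [Qb_congr hvg, setIntegral_congr_fun hYcl.measurableSet hvg] at hopt
  rw [Qb_congr hvg, Qb_congr hvgt, setIntegral_congr_fun hYcl.measurableSet hvgt]
  exact VarOn_le_deficit (M := max B Bt) hΩc hΩ hYΩ hYc hY hgm hgtm
    (fun y hy => (hgB y hy).trans (le_max_left _ _))
    (fun y hy => (hgtB y hy).trans (le_max_right _ _)) hμΩ hμY hΩ0 hμ1 hlam hopt hℓ

end
end

section
/- Let (X,d) be a compact metric space with a lower-semicontinuous pseudo-distance d, p ≥ 1, Y ⊆ X closed, and for t > 0 define Q_t(v)(x) := inf_{y∈Y} { v(y) + d(x,y)^p / t^{p−1} }. Then for every bounded v: Y → ℝ and every s, t > 0, the semigroup inequality Q_t( Q_s(v)|_Y )(x) ≥ Q_{s+t}(v)(x) holds for every x ∈ X. -/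
open MeasureTheory Metric Set Filter
open scoped ENNReal NNReal Topology

noncomputable section

/-- `pd` is a lower-semicontinuous pseudo-distance: nonnegative, null on the diagonal,
symmetric, satisfying the triangle inequality, and lower semicontinuous. -/
def IsLscPseudoDist {X : Type*} [TopologicalSpace X] (pd : X → X → ℝ) : Prop :=
  (∀ x, pd x x = 0) ∧ (∀ x y, 0 ≤ pd x y) ∧ (∀ x y, pd x y = pd y x) ∧
  (∀ x y z, pd x z ≤ pd x y + pd y z) ∧
  LowerSemicontinuous (fun q : X × X => pd q.1 q.2)

/-- The rescaled transform `Q_t(v)(x) = inf_{y ∈ Y} (v(y) + pd(x,y)^p / t^{p−1})`. -/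
def Qt {X : Type*} (pd : X → X → ℝ) (p t : ℝ) (Y : Set X) (v : X → ℝ) (x : X) : ℝ :=
  ⨅ y : Y, (v ↑y + pd x ↑y ^ p / t ^ (p - 1))

/-- Radon's inequality for two terms with real exponent. -/
theorem add_rpow_div_add_rpow_le {p a b s t : ℝ} (hp : 1 ≤ p) (ha : 0 ≤ a) (hb : 0 ≤ b)
    (hs : 0 < s) (ht : 0 < t) :
    (a + b) ^ p / (s + t) ^ (p - 1) ≤ a ^ p / s ^ (p - 1) + b ^ p / t ^ (p - 1) := by
  have hst : 0 < s + t := add_pos hs ht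
  have perspective : ∀ {c r : ℝ}, 0 ≤ c → 0 < r → c ^ p / r ^ (p - 1) = r * (c / r) ^ p := by
    intro c r hc hr
    rw [Real.div_rpow hc hr.le, Real.rpow_sub_one hr.ne']
    field_simp
  have hconv := (convexOn_rpow hp).2 (mem_Ici.2 (div_nonneg ha hs.le))
    (mem_Ici.2 (div_nonneg hb ht.le)) (div_nonneg hs.le hst.le) (div_nonneg ht.le hst.le)
    (by field_simp)
  simp only [smul_eq_mul] at hconv
  have hmean : s / (s + t) * (a / s) + t / (s + t) * (b / t) = (a + b) / (s + t) := by
    field_simp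
  rw [hmean] at hconv
  rw [perspective (add_nonneg ha hb) hst, perspective ha hs, perspective hb ht]
  calc (s + t) * ((a + b) / (s + t)) ^ p
      ≤ (s + t) * (s / (s + t) * (a / s) ^ p + t / (s + t) * (b / t) ^ p) :=
        mul_le_mul_of_nonneg_left hconv hst.le
    _ = s * (a / s) ^ p + t * (b / t) ^ p := by field_simp

/-- semigroup property of the transforms: for a compact metric space `X`
with a lower-semicontinuous pseudo-distance `pd`, `p ≥ 1`, `Y ⊆ X` closed, every bounded
`v : Y → ℝ` and all `s, t > 0`,
`Q_t(Q_s(v)|_Y)(x) ≥ Q_{s+t}(v)(x)` for every `x ∈ X`. -/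
theorem transform_semigroup_inequality
    (X : Type*) [MetricSpace X] [CompactSpace X]
    (pd : X → X → ℝ) (hpd : IsLscPseudoDist pd)
    (p : ℝ) (hp : 1 ≤ p)
    (Y : Set X) (hY : IsClosed Y)
    (v : X → ℝ) (hv : ∃ M : ℝ, ∀ y ∈ Y, |v y| ≤ M)
    (s t : ℝ) (hs : 0 < s) (ht : 0 < t) :
    ∀ x : X, Qt pd p (s + t) Y v x ≤ Qt pd p t Y (fun y => Qt pd p s Y v y) x := by
  obtain ⟨-, hnonneg, -, htri, -⟩ := hpd
  obtain ⟨M, hM⟩ := hv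
  intro x
  have hbdd : BddBelow (range fun z : Y => v z + pd x z ^ p / (s + t) ^ (p - 1)) := by
    refine ⟨-M, ?_⟩
    rintro _ ⟨z, rfl⟩
    have hv_z := neg_le_of_abs_le (hM z z.2)
    have hcost : 0 ≤ pd x z ^ p / (s + t) ^ (p - 1) :=
      div_nonneg (Real.rpow_nonneg (hnonneg _ _) _) (Real.rpow_nonneg (by positivity) _)
    dsimp only
    linarith
  rcases isEmpty_or_nonempty Y with hempty | hne
  · simp [Qt, Real.iInf_of_isEmpty]
  refine le_ciInf fun y => ?_
  rw [← sub_le_iff_le_add]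
  refine le_ciInf fun z => ?_
  have hinf : Qt pd p (s + t) Y v x ≤ v z + pd x z ^ p / (s + t) ^ (p - 1) := ciInf_le hbdd z
  have hradon := add_rpow_div_add_rpow_le hp (hnonneg y z) (hnonneg x y) hs ht
  have hmono : pd x z ^ p / (s + t) ^ (p - 1) ≤ (pd y z + pd x y) ^ p / (s + t) ^ (p - 1) := by
    refine div_le_div_of_nonneg_right ?_ (Real.rpow_nonneg (by positivity) _)
    exact Real.rpow_le_rpow (hnonneg x z) (by linarith [htri x y z]) (by linarith)
  linarith

end
end

section
/- Let (X,d) be a compact metric space with a lower-semicontinuous pseudo-distance, p ≥ 1, μ, λ finite positive Borel measures with μ(X) = λ(X), and X = ∪_k Ω_k a finite or countable Borel partition with λ(Ω_k) > 0 for all k. Then there is c = c(p) < ∞ such that for every ε ∈ (0,1): Wd^p(μ,λ) ≤ (1+ε) Σ_k Wd^p( χ_{Ω_k} μ , (μ(Ω_k)/λ(Ω_k)) χ_{Ω_k} λ ) + c ε^{1−p} Wd^p( Σ_k (μ(Ω_k)/λ(Ω_k)) χ_{Ω_k} λ , λ ). -/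
open MeasureTheory Metric Set Filter
open scoped ENNReal NNReal Topology

noncomputable section

/-- `Wd^p(μ,λ)` for a pseudo-distance `pd`. -/
def WdE {X : Type*} [MeasurableSpace X] (pd : X → X → ℝ) (p : ℝ) (μ lam : Measure X) : ℝ≥0∞ :=
  transportCostE (fun x y => pd x y ^ p) μ lam

/-- Convexity of `t ↦ t ^ p` with weights `1 - ε / (2 * p)` and `ε / (2 * p)`. -/
theorem rpow_add_le_one_add_mul_add {p ε a b : ℝ} (hp : 1 ≤ p) (hε : ε ∈ Ioo (0 : ℝ) 1)
    (ha : 0 ≤ a) (hb : 0 ≤ b) :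
    (a + b) ^ p ≤ (1 + ε) * b ^ p + (2 * p) ^ (p - 1) * ε ^ (1 - p) * a ^ p := by
  obtain ⟨h0, h1⟩ := hε
  have hp0 : 0 < p := by linarith
  set s := ε / (2 * p) with hs
  have hs0 : 0 < s := by positivity
  have hsp : p * s = ε / 2 := by rw [hs]; field_simp
  have hs1 : s < 1 := by nlinarith
  have ht0 : 0 < 1 - s := by linarith
  have weight {w x : ℝ} (hw : 0 < w) (hx : 0 ≤ x) : w * (x / w) ^ p = w ^ (1 - p) * x ^ p := by
    rw [Real.div_rpow hx hw.le, Real.rpow_sub hw, Real.rpow_one]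
    ring
  have hconv : (a + b) ^ p ≤ s ^ (1 - p) * a ^ p + (1 - s) ^ (1 - p) * b ^ p := by
    have := (convexOn_rpow hp).2 (x := a / s) (y := b / (1 - s)) (by simp; positivity)
      (by simp; positivity) hs0.le ht0.le (by ring)
    simp only [smul_eq_mul] at this
    rwa [mul_div_cancel₀ _ hs0.ne', mul_div_cancel₀ _ ht0.ne', weight hs0 ha,
      weight ht0 hb] at this
  have hs_eq : s ^ (1 - p) = (2 * p) ^ (p - 1) * ε ^ (1 - p) := by
    rw [hs, Real.div_rpow h0.le (by positivity), div_eq_mul_inv, ← Real.rpow_neg (by positivity),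
      neg_sub, mul_comm]
  have ht_le : (1 - s) ^ (1 - p) ≤ 1 + ε := by
    have hbern : 1 - ε / 2 ≤ (1 - s) ^ p := by
      have := one_add_mul_self_le_rpow_one_add (s := -s) (by linarith) hp
      rw [← sub_eq_add_neg] at this
      linarith
    have hle : (1 - s) ^ p ≤ (1 - s) ^ (p - 1) :=
      Real.rpow_le_rpow_of_exponent_ge ht0 (by linarith) (by linarith)
    rw [← neg_sub p 1, Real.rpow_neg ht0.le]
    refine inv_le_of_inv_le₀ (by positivity) ((inv_le_of_inv_le₀ (by linarith) ?_).trans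
      (hbern.trans hle))
    rw [inv_le_comm₀ (by linarith) (by linarith), inv_le_iff_one_le_mul₀ (by linarith)]
    nlinarith
  rw [← hs_eq]
  nlinarith [Real.rpow_nonneg hb p]

theorem isFiniteMeasure_of_map {α β : Type*} [MeasurableSpace α] [MeasurableSpace β]
    {π : Measure α} {f : α → β} (hf : Measurable f) [IsFiniteMeasure (π.map f)] :
    IsFiniteMeasure π :=
  ⟨by simpa [Measure.map_apply hf MeasurableSet.univ] using measure_lt_top (π.map f) univ⟩

/-- Gluing of couplings: a coupling of `lam` and `ν` and a coupling of `ν` and `μ` are the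
marginals of a measure on the triple product. -/
theorem exists_gluing {X : Type*} [MeasurableSpace X] [StandardBorelSpace X] [Nonempty X]
    {μ ν lam : Measure X} [IsFiniteMeasure μ] [IsFiniteMeasure lam] {σ π : Measure (X × X)}
    (hσ : σ ∈ couplings ν lam) (hπ : π ∈ couplings μ ν) :
    ∃ γ : Measure ((X × X) × X),
      γ.map Prod.fst = σ ∧ γ.map (fun q => (q.1.2, q.2)) = π := by
  obtain ⟨hσ₁, hσ₂⟩ := hσ
  obtain ⟨hπ₁, hπ₂⟩ := hπ
  have : IsFiniteMeasure (σ.map Prod.fst) := by rw [hσ₁]; infer_instance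
  have : IsFiniteMeasure σ := isFiniteMeasure_of_map measurable_fst
  have : IsFiniteMeasure (π.map Prod.snd) := by rw [hπ₂]; infer_instance
  have : IsFiniteMeasure π := isFiniteMeasure_of_map measurable_snd
  refine ⟨σ.compProd (ProbabilityTheory.Kernel.prodMkLeft X π.condKernel), Measure.fst_compProd _ _, ?_⟩
  refine Measure.ext_of_lintegral _ fun f hf => ?_
  rw [lintegral_map hf (by fun_prop), Measure.lintegral_compProd (by fun_prop)]
  simp only [ProbabilityTheory.Kernel.prodMkLeft_apply]
  conv_rhs => rw [← π.disintegrate π.condKernel, Measure.lintegral_compProd hf, Measure.fst,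
    hπ₁, ← hσ₂]
  rw [lintegral_map hf.lintegral_kernel_prod_right' measurable_snd]

/-- Approximate triangle inequality for the transport cost. -/
theorem WdE_le_add {X : Type*} [MeasurableSpace X] [StandardBorelSpace X] {pd : X → X → ℝ}
    (hpd : Measurable fun q : X × X => pd q.1 q.2) (h_nonneg : ∀ x y, 0 ≤ pd x y)
    (h_triangle : ∀ x y z, pd x z ≤ pd x y + pd y z) {p ε : ℝ} (hp : 1 ≤ p)
    (hε : ε ∈ Ioo (0 : ℝ) 1) (μ ν lam : Measure X) [IsFiniteMeasure μ] [IsFiniteMeasure lam] :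
    WdE pd p μ lam ≤ ENNReal.ofReal (1 + ε) * WdE pd p μ ν +
      ENNReal.ofReal ((2 * p) ^ (p - 1) * ε ^ (1 - p)) * WdE pd p ν lam := by
  obtain ⟨hε₀, hε₁⟩ := id hε
  have hB : 0 < (2 * p) ^ (p - 1) * ε ^ (1 - p) := by positivity
  have hcost : Measurable fun q : X × X => ENNReal.ofReal (pd q.1 q.2 ^ p) :=
    (hpd.pow_const p).ennreal_ofReal
  unfold WdE transportCostE
  rcases isEmpty_or_nonempty X with hX | hX
  · exact (iInf₂_le 0 ⟨Subsingleton.elim _ _, Subsingleton.elim _ _⟩).trans (by simp)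
  have mul_inf {A : ℝ} (hA : 0 < A) (s : Set (Measure (X × X)))
      (F : Measure (X × X) → ℝ≥0∞) :
      ENNReal.ofReal A * ⨅ π ∈ s, F π = ⨅ π ∈ s, ENNReal.ofReal A * F π := by
    simp_rw [ENNReal.mul_iInf_of_ne (ENNReal.ofReal_pos.2 hA).ne' ENNReal.ofReal_ne_top]
  rw [mul_inf (by linarith), mul_inf hB]
  refine ENNReal.le_iInf₂_add_iInf₂ fun π hπ σ hσ => ?_
  obtain ⟨γ, hγσ, hγπ⟩ := exists_gluing hσ hπ
  have hout : Measurable fun q : (X × X) × X => (q.1.1, q.2) := by fun_prop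
  refine iInf₂_le_of_le (γ.map fun q => (q.1.1, q.2)) ⟨?_, ?_⟩ ?_
  · rw [Measure.map_map measurable_fst hout, ← hσ.1, ← hγσ,
      Measure.map_map measurable_fst measurable_fst]
    rfl
  · rw [Measure.map_map measurable_snd hout, ← hπ.2, ← hγπ,
      Measure.map_map measurable_snd (by fun_prop)]
    rfl
  have hπ_int : ∫⁻ z, ENNReal.ofReal (pd z.1 z.2 ^ p) ∂π =
      ∫⁻ q, ENNReal.ofReal (pd q.1.2 q.2 ^ p) ∂γ := by
    rw [← hγπ, lintegral_map hcost (by fun_prop)]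
  have hσ_int : ∫⁻ z, ENNReal.ofReal (pd z.1 z.2 ^ p) ∂σ =
      ∫⁻ q, ENNReal.ofReal (pd q.1.1 q.1.2 ^ p) ∂γ := by
    rw [← hγσ, lintegral_map hcost measurable_fst]
  have hπ_meas : Measurable fun q : (X × X) × X => ENNReal.ofReal (pd q.1.2 q.2 ^ p) :=
    hcost.comp (g := fun q : X × X => ENNReal.ofReal (pd q.1 q.2 ^ p))
      (f := fun q : (X × X) × X => (q.1.2, q.2)) (by fun_prop)
  rw [lintegral_map hcost hout, hπ_int, hσ_int,
    ← lintegral_const_mul' _ _ ENNReal.ofReal_ne_top,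
    ← lintegral_const_mul' _ _ ENNReal.ofReal_ne_top,
    ← lintegral_add_left (hπ_meas.const_mul _)]
  refine lintegral_mono fun q => ?_
  rw [← ENNReal.ofReal_mul (by linarith), ← ENNReal.ofReal_mul hB.le,
    ← ENNReal.ofReal_add (mul_nonneg (by linarith) (Real.rpow_nonneg (h_nonneg _ _) _))
      (mul_nonneg hB.le (Real.rpow_nonneg (h_nonneg _ _) _))]
  refine ENNReal.ofReal_le_ofReal ?_
  exact (Real.rpow_le_rpow (h_nonneg _ _) (h_triangle _ q.1.2 _) (by linarith)).trans
    (rpow_add_le_one_add_mul_add hp hε (h_nonneg _ _) (h_nonneg _ _))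

/-- Countable subadditivity of the transport cost. -/
theorem transportCostE_sum_le {X ι : Type*} [MeasurableSpace X] [Countable ι]
    (c : X → X → ℝ) (μ lam : ι → Measure X) :
    transportCostE c (Measure.sum μ) (Measure.sum lam) ≤
      ∑' k, transportCostE c (μ k) (lam k) := by
  refine ENNReal.le_of_forall_pos_le_add fun δ hδ hfin => ?_
  obtain ⟨δ', hδ', hsum⟩ := ENNReal.exists_pos_sum_of_countable' (ENNReal.coe_ne_zero.2 hδ.ne') ι
  have hex (k : ι) : ∃ π ∈ couplings (μ k) (lam k),
      ∫⁻ z, ENNReal.ofReal (c z.1 z.2) ∂π ≤ transportCostE c (μ k) (lam k) + δ' k := by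
    have hlt := ENNReal.lt_add_right (ENNReal.ne_top_of_tsum_ne_top hfin.ne k) (hδ' k).ne'
    conv_lhs at hlt => unfold transportCostE
    simp only [iInf_lt_iff] at hlt
    obtain ⟨π, hπ, h⟩ := hlt
    exact ⟨π, hπ, h.le⟩
  choose π hπ hle using hex
  refine iInf₂_le_of_le (Measure.sum π) ⟨?_, ?_⟩ ?_
  · rw [Measure.map_sum measurable_fst.aemeasurable]
    exact congrArg _ (funext fun k => (hπ k).1)
  · rw [Measure.map_sum measurable_snd.aemeasurable]
    exact congrArg _ (funext fun k => (hπ k).2)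
  rw [lintegral_sum_measure]
  refine (ENNReal.tsum_le_tsum hle).trans ?_
  rw [ENNReal.tsum_add]
  gcongr

/-- approximate sub-additivity, eq. (3.16): for every `p ≥ 1` there is
`c = c(p)` such that for every compact metric space `X` with a lower-semicontinuous
pseudo-distance `pd`, all finite Borel measures `μ, λ` of equal total mass, every finite or
countable Borel partition `X = ∪_k Ω_k` with `λ(Ω_k) > 0`, and every `ε ∈ (0,1)`,
`Wd^p(μ,λ) ≤ (1+ε) Σ_k Wd^p(χ_{Ω_k} μ, (μ(Ω_k)/λ(Ω_k)) χ_{Ω_k} λ)`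
`+ c ε^{1−p} Wd^p(Σ_k (μ(Ω_k)/λ(Ω_k)) χ_{Ω_k} λ, λ)`. -/
theorem wd_subadditivity (p : ℝ) (hp : 1 ≤ p) :
    ∃ c : ℝ, 0 < c ∧
    ∀ (X : Type) [MetricSpace X] [CompactSpace X] [MeasurableSpace X] [BorelSpace X]
      (pd : X → X → ℝ), IsLscPseudoDist pd →
    ∀ (μ lam : Measure X), IsFiniteMeasure μ → IsFiniteMeasure lam →
      μ Set.univ = lam Set.univ →
    ∀ (ι : Type) (_ : Countable ι) (Ωk : ι → Set X),
      (∀ k, MeasurableSet (Ωk k)) → (⋃ k, Ωk k) = Set.univ →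
      (Pairwise fun k h => Disjoint (Ωk k) (Ωk h)) → (∀ k, 0 < lam (Ωk k)) →
    ∀ ε : ℝ, ε ∈ Ioo (0:ℝ) 1 →
      WdE pd p μ lam ≤
        ENNReal.ofReal (1 + ε) *
            (∑' k, WdE pd p (μ.restrict (Ωk k))
              ((μ (Ωk k) / lam (Ωk k)) • lam.restrict (Ωk k))) +
          ENNReal.ofReal (c * ε ^ (1 - p)) *
            WdE pd p (Measure.sum fun k => (μ (Ωk k) / lam (Ωk k)) • lam.restrict (Ωk k))
              lam := by
  refine ⟨(2 * p) ^ (p - 1), by positivity, ?_⟩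
  intro X _ _ _ _ pd hpd μ lam _ _ _ ι _ Ωk hmeas hcover hdisj _ ε hε
  obtain ⟨-, h_nonneg, -, h_triangle, hlsc⟩ := hpd
  refine (WdE_le_add hlsc.measurable h_nonneg h_triangle hp hε μ
    (Measure.sum fun k => (μ (Ωk k) / lam (Ωk k)) • lam.restrict (Ωk k)) lam).trans ?_
  gcongr
  refine le_trans (le_of_eq ?_) (transportCostE_sum_le _ _ _)
  rw [← Measure.restrict_iUnion hdisj hmeas, hcover, Measure.restrict_univ]
  rfl

end
end
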